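/- Let K have characteristic 2 and let k ≥ 2 be even. In A = A^{k,s}(a,c): (i) if c = 0 and s is odd then T₁(A) = [A,A] + span_K({α} ∪ {η^t : (s−1)/2 < t ≤ s−1} ∪ {(βγα)^m : k/2 < m ≤ k}); (ii) if c = 0 and s is even then T₁(A) = [A,A] + span_K({α, η^{s/2} + (βγα)^{k/2}} ∪ {η^t : s/2 < t ≤ s−1} ∪ {(βγα)^m : k/2 < m ≤ k}); (iii) if s is odd and c is nonzero and not a square in K then T₁(A) = [A,A] + span_K({η^t : (s−1)/2 < t ≤ s−1} ∪ {(βγα)^m : k/2 < m ≤ k}); (iv) if s is odd and c = d² for some nonzero d ∈ K then T₁(A) = [A,A] + span_K({α + d(βγα)^{k/2}} ∪ {η^t : (s−1)/2 < t ≤ s−1} ∪ {(βγα)^m : k/2 < m ≤ k}); (v) if s is even and c is nonzero and not a square in K then T₁(A) = [A,A] + span_K({η^{s/2} + (βγα)^{k/2}} ∪ {η^t : s/2 < t ≤ s−1} ∪ {(βγα)^m : k/2 < m ≤ k}); (vi) if s is even and c = d² for some nonzero d ∈ K then T₁(A) = [A,A] + span_K({η^{s/2} + (βγα)^{k/2},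 α + dη^{s/2}} ∪ {η^t : s/2 < t ≤ s−1} ∪ {(βγα)^m : k/2 < m ≤ k}). -/

import Mathlib

namespace QT

/-- The generators of the free algebra: the two vertex idempotents `e1, e2`,
the loops `al` (α at vertex 1) and `et` (η at vertex 2), and the arrows
`be` (β : 1 → 2) and `ga` (γ : 2 → 1). -/
inductive Gen : Type
  | e1 : Gen
  | e2 : Gen
  | al : Gen
  | be : Gen
  | ga : Gen
  | et : Gen

open Gen

/-- Generators as elements of the free algebra. -/
noncomputable def gen (K : Type) [Field K] (g : Gen) : FreeAlgebra K Gen :=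
  FreeAlgebra.ι K g

/-- The defining relations of the algebra `A^{k,s}(a,c)`: the path-algebra
relations for the quiver with two vertices, loops α, η and arrows β, γ
(paths composed left to right), together with the relations
βη = (αβγ)^{k−1}αβ, ηγ = (γαβ)^{k−1}γα, α² = a(βγα)^{k−1}βγ + c(βγα)^k,
γβ = η^{s−1}, α²β = 0, γα² = 0. -/
inductive Rel (K : Type) [Field K] (k s : ℕ) (a c : K) :
    FreeAlgebra K Gen → FreeAlgebra K Gen → Prop
  | idem1 : Rel K k s a c (gen K e1 * gen K e1) (gen K e1)
  | idem2 : Rel K k s a c (gen K e2 * gen K e2) (gen K e2)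
  | orth12 : Rel K k s a c (gen K e1 * gen K e2) 0
  | orth21 : Rel K k s a c (gen K e2 * gen K e1) 0
  | sum_idem : Rel K k s a c (gen K e1 + gen K e2) 1
  | al_left : Rel K k s a c (gen K e1 * gen K al) (gen K al)
  | al_right : Rel K k s a c (gen K al * gen K e1) (gen K al)
  | be_left : Rel K k s a c (gen K e1 * gen K be) (gen K be)
  | be_right : Rel K k s a c (gen K be * gen K e2) (gen K be)
  | ga_left : Rel K k s a c (gen K e2 * gen K ga) (gen K ga)
  | ga_right : Rel K k s a c (gen K ga * gen K e1) (gen K ga)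
  | et_left : Rel K k s a c (gen K e2 * gen K et) (gen K et)
  | et_right : Rel K k s a c (gen K et * gen K e2) (gen K et)
  | rel_beta_eta : Rel K k s a c (gen K be * gen K et)
      ((gen K al * gen K be * gen K ga) ^ (k - 1) * (gen K al * gen K be))
  | rel_eta_gamma : Rel K k s a c (gen K et * gen K ga)
      ((gen K ga * gen K al * gen K be) ^ (k - 1) * (gen K ga * gen K al))
  | rel_alpha_sq : Rel K k s a c (gen K al * gen K al)
      (a • ((gen K be * gen K ga * gen K al) ^ (k - 1) * (gen K be * gen K ga)) +
        c • (gen K be * gen K ga * gen K al) ^ k)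
  | rel_gamma_beta : Rel K k s a c (gen K ga * gen K be) ((gen K et) ^ (s - 1))
  | rel_alpha_sq_beta : Rel K k s a c (gen K al * gen K al * gen K be) 0
  | rel_gamma_alpha_sq : Rel K k s a c (gen K ga * (gen K al * gen K al)) 0

/-- The algebra `A^{k,s}(a,c)` of quaternion type with two simple modules. -/
abbrev Aa (K : Type) [Field K] (k s : ℕ) (a c : K) : Type :=
  RingQuot (Rel K k s a c)

variable (K : Type) [Field K] (k s : ℕ) (a c : K)

/-- The idempotent e₁ in `A^{k,s}(a,c)`. -/
noncomputable def E1 : Aa K k s a c := RingQuot.mkAlgHom K (Rel K k s a c) (gen K e1)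
/-- The idempotent e₂ in `A^{k,s}(a,c)`. -/
noncomputable def E2 : Aa K k s a c := RingQuot.mkAlgHom K (Rel K k s a c) (gen K e2)
/-- The loop α in `A^{k,s}(a,c)`. -/
noncomputable def Al : Aa K k s a c := RingQuot.mkAlgHom K (Rel K k s a c) (gen K al)
/-- The arrow β in `A^{k,s}(a,c)`. -/
noncomputable def Be : Aa K k s a c := RingQuot.mkAlgHom K (Rel K k s a c) (gen K be)
/-- The arrow γ in `A^{k,s}(a,c)`. -/
noncomputable def Ga : Aa K k s a c := RingQuot.mkAlgHom K (Rel K k s a c) (gen K ga)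
/-- The loop η in `A^{k,s}(a,c)`. -/
noncomputable def Et : Aa K k s a c := RingQuot.mkAlgHom K (Rel K k s a c) (gen K et)

/-- The commutator subspace [A,A]: the K-subspace spanned by all commutators. -/
noncomputable def comm : Submodule K (Aa K k s a c) :=
  Submodule.span K {z : Aa K k s a c | ∃ u v : Aa K k s a c, z = u * v - v * u}

/-- Index type for the basis B = B₁ ∪ B₂ ∪ B₃ ∪ B₄ of `A^{k,s}(a,c)`. -/
abbrev BIdx (k s : ℕ) : Type :=
  ((Fin k ⊕ Fin k) ⊕ (Fin (k - 1) ⊕ Fin (k + 1))) ⊕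
    ((Fin (s + 1) ⊕ Fin (k - 1)) ⊕ ((Fin k ⊕ Fin k) ⊕ (Fin k ⊕ Fin k)))

/-- The family of elements of `A^{k,s}(a,c)` given by
B₁ = {α(βγα)^n, (βγα)^nβγ : 0 ≤ n ≤ k−1} ∪ {(βγα)^m : 1 ≤ m ≤ k−1} ∪ {(αβγ)^ℓ : 0 ≤ ℓ ≤ k},
B₂ = {η^t : 0 ≤ t ≤ s} ∪ {(γαβ)^m : 1 ≤ m ≤ k−1},
B₃ = {(βγα)^nβ, α(βγα)^nβ : 0 ≤ n ≤ k−1},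
B₄ = {(γαβ)^nγ, (γαβ)^nγα : 0 ≤ n ≤ k−1}. -/
noncomputable def bVec : BIdx k s → Aa K k s a c := fun i =>
  let α := Al K k s a c
  let β := Be K k s a c
  let γ := Ga K k s a c
  let η := Et K k s a c
  match i with
  | .inl (.inl (.inl n)) => α * (β * γ * α) ^ (n : ℕ)
  | .inl (.inl (.inr n)) => (β * γ * α) ^ (n : ℕ) * (β * γ)
  | .inl (.inr (.inl m)) => (β * γ * α) ^ ((m : ℕ) + 1)
  | .inl (.inr (.inr l)) => (α * β * γ) ^ (l : ℕ)
  | .inr (.inl (.inl t)) => η ^ (t : ℕ)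
  | .inr (.inl (.inr m)) => (γ * α * β) ^ ((m : ℕ) + 1)
  | .inr (.inr (.inl (.inl n))) => (β * γ * α) ^ (n : ℕ) * β
  | .inr (.inr (.inl (.inr n))) => α * (β * γ * α) ^ (n : ℕ) * β
  | .inr (.inr (.inr (.inl n))) => (γ * α * β) ^ (n : ℕ) * γ
  | .inr (.inr (.inr (.inr n))) => (γ * α * β) ^ (n : ℕ) * (γ * α)

/-- `ψ` is the linear form on `A^{k,s}(a,c)` sending η^s and (αβγ)^k to 1 and every
other element of the basis B to 0. -/
noncomputable def IsPsi (ψ : Aa K k s a c →ₗ[K] K) : Prop :=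
  ψ ((Et K k s a c) ^ s) = 1 ∧
  ψ ((Al K k s a c * Be K k s a c * Ga K k s a c) ^ k) = 1 ∧
  ∀ i : BIdx k s, bVec K k s a c i ≠ (Et K k s a c) ^ s →
    bVec K k s a c i ≠ (Al K k s a c * Be K k s a c * Ga K k s a c) ^ k →
    ψ (bVec K k s a c i) = 0

/-- The set T₁(A) = {x ∈ A : x² ∈ [A,A]} (characteristic 2). -/
noncomputable def T1 : Set (Aa K k s a c) :=
  {z : Aa K k s a c | z ^ 2 ∈ comm K k s a c}

/-- The orthogonal space T₁(A)^⊥ of T₁(A) with respect to the symmetrising form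
⟨u,v⟩ = ψ(uv): the space of all z with ψ(z·m) = 0 for all m ∈ T₁(A). -/
noncomputable def perp (ψ : Aa K k s a c →ₗ[K] K) : Submodule K (Aa K k s a c) :=
  ⨅ m ∈ T1 K k s a c, LinearMap.ker (ψ ∘ₗ LinearMap.mulRight K m)

end QT

namespace QT

variable (K : Type) [Field K] (k s : ℕ) (a c : K)

/-- The set of powers η^t with n < 2t and t ≤ s−1 (i.e. n/2 < t ≤ s−1). -/
noncomputable def etaAbove (n : ℕ) : Set (Aa K k s a c) :=
  {z : Aa K k s a c | ∃ t : ℕ, n < 2 * t ∧ t ≤ s - 1 ∧ z = (Et K k s a c) ^ t}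

/-- The set of powers (βγα)^m with n < 2m and m ≤ k (i.e. n/2 < m ≤ k). -/
noncomputable def cycAbove (n : ℕ) : Set (Aa K k s a c) :=
  {z : Aa K k s a c | ∃ m : ℕ, n < 2 * m ∧ m ≤ k ∧
    z = (Be K k s a c * Ga K k s a c * Al K k s a c) ^ m}

end QT

namespace QT
open Gen

section descend
variable {K : Type} [Field K] {k s : ℕ} {a c : K}

/-- the congruence attached to a symmetric functional -/
def fcon (G : FreeAlgebra K Gen →ₗ[K] K) (cyc : ∀ x y, G (x * y) = G (y * x)) :
    RingCon (FreeAlgebra K Gen) where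
  r x y := ∀ w, G (x * w) = G (y * w)
  iseqv := ⟨fun _ _ => rfl, fun h w => (h w).symm, fun h h' w => (h w).trans (h' w)⟩
  mul' := by
    intro x x' y y' h h' w
    rw [mul_assoc, h, cyc, mul_assoc, h', ← mul_assoc, cyc, mul_assoc]
  add' := by
    intro x x' y y' h h' w
    rw [add_mul, add_mul, map_add, map_add, h, h']

theorem descend (G : FreeAlgebra K Gen →ₗ[K] K) (cyc : ∀ x y, G (x * y) = G (y * x))
    (hrel : ∀ x y, Rel K k s a c x y → ∀ w, G (x * w) = G (y * w)) :
    ∃ F : Aa K k s a c →ₗ[K] K,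
      (∀ x, F (RingQuot.mkAlgHom K (Rel K k s a c) x) = G x) ∧
      ∀ z ∈ comm K k s a c, F z = 0 := by
  have surj := RingQuot.mkAlgHom_surjective K (Rel K k s a c)
  let q : FreeAlgebra K Gen →+* (fcon G cyc).Quotient := (fcon G cyc).mk'
  have hq : ∀ ⦃x y⦄, Rel K k s a c x y → q x = q y := by
    intro x y h
    exact (RingCon.eq _).2 (hrel x y h)
  have key : ∀ x y, RingQuot.mkAlgHom K (Rel K k s a c) x =
      RingQuot.mkAlgHom K (Rel K k s a c) y → G x = G y := by
    intro x y h
    have e : ∀ x, RingQuot.mkAlgHom K (Rel K k s a c) x = RingQuot.mkRingHom (Rel K k s a c) x := by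
      intro x
      rw [← RingQuot.mkAlgHom_coe K]; rfl
    rw [e, e] at h
    have h2 := congrArg (RingQuot.lift ⟨q, hq⟩) h
    rw [RingQuot.lift_mkRingHom_apply, RingQuot.lift_mkRingHom_apply] at h2
    have h3 := (RingCon.eq _).1 h2 1
    simpa using h3
  choose g hg using surj
  have hF : ∀ x, G (g (RingQuot.mkAlgHom K (Rel K k s a c) x)) = G x := fun x => key _ _ (hg _)
  let F : Aa K k s a c →ₗ[K] K :=
    { toFun := fun z => G (g z)
      map_add' := by
        intro x y
        rw [← map_add]
        apply key
        rw [hg, map_add, hg, hg]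
      map_smul' := by
        intro r x
        rw [RingHom.id_apply, ← map_smul]
        apply key
        rw [hg, map_smul, hg] }
  refine ⟨F, hF, ?_⟩
  intro z hz
  have : comm K k s a c ≤ LinearMap.ker F := by
    unfold comm
    rw [Submodule.span_le]
    rintro _ ⟨u, v, rfl⟩
    rw [SetLike.mem_coe, LinearMap.mem_ker]
    rw [← hg u, ← hg v, ← map_mul, ← map_mul, ← map_sub]
    change G (g _) = 0
    rw [hF, map_sub, cyc, sub_self]
  exact this hz
end descend

section words
variable {K : Type} [Field K] {k s : ℕ} {a c : K}

/-- words in the four arrows -/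
abbrev WA (K : Type) [Field K] : Type := MonoidAlgebra K (FreeMonoid (Fin 4))

/-- a word in the monoid algebra -/
noncomputable def wd (l : List (Fin 4)) : WA K := MonoidAlgebra.single (FreeMonoid.ofList l) 1

theorem wd_mul (l m : List (Fin 4)) : (wd l : WA K) * wd m = wd (l ++ m) := by
  simp [wd, MonoidAlgebra.single_mul_single]

theorem wd_nil : (wd [] : WA K) = 1 := rfl

/-- power of a list -/
def rep (l : List (Fin 4)) : ℕ → List (Fin 4)
  | 0 => []
  | n + 1 => l ++ rep l n

theorem wd_pow (l : List (Fin 4)) (n : ℕ) : (wd l : WA K) ^ n = wd (rep l n) := by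
  induction n with
  | zero => rfl
  | succ n ih => rw [pow_succ', ih, wd_mul]; rfl

/-- linear extension of a function on words -/
noncomputable def pf (f : List (Fin 4) → K) : WA K →ₗ[K] K :=
  (Finsupp.linearCombination K (fun m : FreeMonoid (Fin 4) => f m.toList)) ∘ₗ
    (MonoidAlgebra.coeffLinearEquiv K).toLinearMap

theorem pf_wd (f : List (Fin 4) → K) (l : List (Fin 4)) : pf f (wd l) = f l := by
  simp [pf, wd]

theorem WA_ind {P : WA K → Prop} (x : WA K) (h0 : ∀ l, P (wd l)) (ha : ∀ x y, P x → P y → P (x + y))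
    (hs : ∀ (r : K) x, P x → P (r • x)) : P x := by
  induction x using MonoidAlgebra.induction_on with
  | of m => exact h0 m.toList
  | add x y hx hy => exact ha x y hx hy
  | smul r x hx => exact hs r x hx

theorem pf_cyc (f : List (Fin 4) → K) (hf : ∀ l m, f (l ++ m) = f (m ++ l)) (x y : WA K) :
    pf f (x * y) = pf f (y * x) := by
  induction x using WA_ind with
  | h0 l =>
    induction y using WA_ind with
    | h0 m => rw [wd_mul, wd_mul, pf_wd, pf_wd, hf]
    | ha x y h1 h2 => simp [mul_add, add_mul, h1, h2]
    | hs r x h => simp [h]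
  | ha x y h1 h2 => simp [mul_add, add_mul, h1, h2]
  | hs r x h => simp [h]

theorem pf_ext (f : List (Fin 4) → K) (p q : WA K)
    (h : ∀ l, pf f (p * wd l) = pf f (q * wd l)) (w : WA K) : pf f (p * w) = pf f (q * w) := by
  induction w using WA_ind with
  | h0 l => exact h l
  | ha x y h1 h2 => simp [mul_add, h1, h2]
  | hs r x h => simp [h]

/-- the matrix representation -/
noncomputable def mrep : FreeAlgebra K Gen →ₐ[K] Matrix (Fin 2) (Fin 2) (WA K) :=
  FreeAlgebra.lift K (fun g => match g with
    | e1 => !![1, 0; 0, 0]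
    | e2 => !![0, 0; 0, 1]
    | al => !![wd [0], 0; 0, 0]
    | be => !![0, wd [1]; 0, 0]
    | ga => !![0, 0; wd [2], 0]
    | et => !![0, 0; 0, wd [3]])

theorem mrep_e1 : mrep (gen K e1) = !![1, 0; 0, 0] := by simp [mrep, gen]
theorem mrep_e2 : mrep (gen K e2) = !![0, 0; 0, 1] := by simp [mrep, gen]
theorem mrep_al : mrep (gen K al) = !![wd [0], 0; 0, 0] := by simp [mrep, gen]
theorem mrep_be : mrep (gen K be) = !![0, wd [1]; 0, 0] := by simp [mrep, gen]
theorem mrep_ga : mrep (gen K ga) = !![0, 0; wd [2], 0] := by simp [mrep, gen]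
theorem mrep_et : mrep (gen K et) = !![0, 0; 0, wd [3]] := by simp [mrep, gen]

theorem m11_pow (p : WA K) (n : ℕ) (hn : 1 ≤ n) :
    (!![p, 0; 0, 0] : Matrix (Fin 2) (Fin 2) (WA K)) ^ n = !![p ^ n, 0; 0, 0] := by
  induction n, hn using Nat.le_induction with
  | base => simp
  | succ n hn ih => rw [pow_succ, ih, pow_succ, Matrix.mul_fin_two]; simp

theorem m22_pow (p : WA K) (n : ℕ) (hn : 1 ≤ n) :
    (!![0, 0; 0, p] : Matrix (Fin 2) (Fin 2) (WA K)) ^ n = !![0, 0; 0, p ^ n] := by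
  induction n, hn using Nat.le_induction with
  | base => simp
  | succ n hn ih => rw [pow_succ, ih, pow_succ, Matrix.mul_fin_two]; simp

theorem word_trace (hk : 2 ≤ k) (hs : 3 ≤ s) (f : List (Fin 4) → K)
    (hf : ∀ l m, f (l ++ m) = f (m ++ l))
    (r1 : ∀ w, f ([1, 3] ++ w) = f (rep [0, 1, 2] (k - 1) ++ [0, 1] ++ w))
    (r2 : ∀ w, f ([3, 2] ++ w) = f (rep [2, 0, 1] (k - 1) ++ [2, 0] ++ w))
    (r3 : ∀ w, f ([0, 0] ++ w) = a * f (rep [1, 2, 0] (k - 1) ++ [1, 2] ++ w)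
      + c * f (rep [1, 2, 0] k ++ w))
    (r4 : ∀ w, f ([2, 1] ++ w) = f (rep [3] (s - 1) ++ w))
    (r5 : ∀ w, f ([0, 0, 1] ++ w) = 0)
    (r6 : ∀ w, f ([2, 0, 0] ++ w) = 0) :
    ∃ F : Aa K k s a c →ₗ[K] K, (∀ z ∈ comm K k s a c, F z = 0) ∧
      F (E1 K k s a c) = f [] ∧ F (E2 K k s a c) = f [] ∧
      F (Al K k s a c ^ 2) = f [0, 0] ∧
      (∀ n, 1 ≤ n → F (Et K k s a c ^ n) = f (rep [3] n)) ∧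
      (∀ n, 1 ≤ n → F ((Be K k s a c * Ga K k s a c * Al K k s a c) ^ n) = f (rep [1, 2, 0] n)) := by
  let G : FreeAlgebra K Gen →ₗ[K] K :=
    pf f ∘ₗ (Matrix.traceLinearMap (Fin 2) K (WA K)) ∘ₗ mrep.toLinearMap
  have hG : ∀ x, G x = pf f (mrep x 0 0) + pf f (mrep x 1 1) := by
    intro x
    simp [G, Matrix.trace_fin_two]
  have hcyc : ∀ x y, G (x * y) = G (y * x) := by
    intro x y
    rw [hG, hG, map_mul, map_mul]
    simp only [Matrix.mul_apply, Fin.sum_univ_two, map_add]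
    rw [pf_cyc f hf (mrep x 0 0), pf_cyc f hf (mrep x 0 1), pf_cyc f hf (mrep x 1 0),
      pf_cyc f hf (mrep x 1 1)]
    ring
  have hrel : ∀ x y, Rel K k s a c x y → ∀ w, G (x * w) = G (y * w) := by
    intro x y h w
    rw [hG, hG, map_mul, map_mul]
    have hk1 : 1 ≤ k - 1 := by omega
    have hk0 : 1 ≤ k := by omega
    have hs1 : 1 ≤ s - 1 := by omega
    rw [Matrix.eta_fin_two (mrep w)]
    cases h <;>
      simp only [map_mul, map_add, map_pow, map_smul, map_zero, map_one,
        mrep_e1, mrep_e2, mrep_al, mrep_be, mrep_ga, mrep_et, wd_mul, Matrix.mul_fin_two,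
        mul_zero, zero_mul, mul_one, one_mul, add_zero, zero_add,
        m11_pow _ _ hk1, m11_pow _ _ hk0, m22_pow _ _ hs1, m22_pow _ _ hk1, wd_pow,
        List.cons_append, List.nil_append]
    case rel_beta_eta =>
      simp
      refine pf_ext f _ _ (fun l => ?_) _
      rw [wd_mul, wd_mul, pf_wd, pf_wd, r1]
    case rel_eta_gamma =>
      simp
      refine pf_ext f _ _ (fun l => ?_) _
      rw [wd_mul, wd_mul, pf_wd, pf_wd, r2]
    case rel_alpha_sq =>
      simp
      refine pf_ext f _ _ (fun l => ?_) _
      rw [add_mul, smul_mul_assoc, smul_mul_assoc, wd_mul, wd_mul, wd_mul, map_add, map_smul,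
        map_smul, pf_wd, pf_wd, pf_wd, r3]
      rfl
    case rel_gamma_beta =>
      simp
      refine pf_ext f _ _ (fun l => ?_) _
      rw [wd_mul, wd_mul, pf_wd, pf_wd, r4]
    case rel_alpha_sq_beta =>
      simp
      rw [← map_zero (pf f), ← zero_mul (mrep w 1 0)]
      refine pf_ext f _ _ (fun l => ?_) _
      rw [wd_mul, pf_wd, r5]; simp
    case rel_gamma_alpha_sq =>
      simp
      rw [← map_zero (pf f), ← zero_mul (mrep w 0 1)]
      refine pf_ext f _ _ (fun l => ?_) _
      rw [wd_mul, pf_wd, r6]; simp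
    all_goals simp [← Matrix.one_fin_two]
  obtain ⟨F, hF, hF'⟩ := descend (k := k) (s := s) (a := a) (c := c) G hcyc hrel
  refine ⟨F, hF', ?_, ?_, ?_, ?_, ?_⟩
  · rw [E1, hF, hG, mrep_e1]; simp [← wd_nil, pf_wd]
  · rw [E2, hF, hG, mrep_e2]; simp [← wd_nil, pf_wd]
  · rw [Al, ← map_pow, hF, hG, map_pow, mrep_al, m11_pow _ _ (by norm_num), wd_pow]
    simp [pf_wd, rep]
  · intro n hn
    rw [Et, ← map_pow, hF, hG, map_pow, mrep_et, m22_pow _ _ hn, wd_pow]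
    simp [pf_wd]
  · intro n hn
    rw [Be, Ga, Al, ← map_mul, ← map_mul, ← map_pow, hF, hG, map_pow, map_mul, map_mul,
      mrep_al, mrep_be, mrep_ga]
    simp only [Matrix.mul_fin_two, mul_zero, zero_mul, add_zero, zero_add, wd_mul, m11_pow _ _ hn,
      wd_pow]
    simp [pf_wd]
end words
end QT
namespace QT
open Gen
section traces
variable {K : Type} [Field K] {k s : ℕ} {a c : K}

theorem cyc_of_shift (P : List (Fin 4) → Prop) (h : ∀ x l, P (x :: l) → P (l ++ [x]))
    (l m : List (Fin 4)) : P (l ++ m) ↔ P (m ++ l) := by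
  have key : ∀ l m : List (Fin 4), P (l ++ m) → P (m ++ l) := by
    intro l
    induction l with
    | nil => intro m hm; simpa using hm
    | cons x l ih =>
      intro m hm
      have := ih (m ++ [x]) (by simpa using h _ _ hm)
      simpa using this
  exact ⟨key l m, key m l⟩

theorem rep_len (l : List (Fin 4)) (n : ℕ) : (rep l n).length = n * l.length := by
  induction n with
  | zero => simp [rep]
  | succ n ih => simp [rep, ih]; ring

theorem rep_succ' (l : List (Fin 4)) (n : ℕ) : rep l (n + 1) = rep l n ++ l := by
  induction n with
  | zero => simp [rep]
  | succ n ih =>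
    have e : rep l (n + 1 + 1) = l ++ rep l (n + 1) := rfl
    rw [e, ih, ← List.append_assoc]
    exact congrArg (· ++ l) ih

theorem rep_shift (x y z : Fin 4) (n : ℕ) : rep [x, y, z] n ++ [x] = x :: rep [y, z, x] n := by
  induction n with
  | zero => simp [rep]
  | succ n ih => simp [rep, ih]

theorem rep_three (n : ℕ) (x : Fin 4) : rep [x] n ++ [x] = x :: rep [x] n := by
  rw [← rep_succ']; rfl

/-- rotations of the big cycle -/
def cycR (m : ℕ) (l : List (Fin 4)) : Prop :=
  l = rep [0, 1, 2] m ∨ l = rep [1, 2, 0] m ∨ l = rep [2, 0, 1] m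

theorem cycR_shift (m : ℕ) (x l) (h : cycR m (x :: l)) : cycR m (l ++ [x]) := by
  cases m with
  | zero => simp [cycR, rep] at h
  | succ n =>
    unfold cycR at *
    rcases h with h | h | h
    · simp only [rep, List.cons_append, List.cons.injEq, List.nil_append] at h
      obtain ⟨rfl, rfl⟩ := h
      right; left
      simp [rep, rep_shift]
    · simp only [rep, List.cons_append, List.cons.injEq, List.nil_append] at h
      obtain ⟨rfl, rfl⟩ := h
      right; right
      simp [rep, rep_shift]
    · simp only [rep, List.cons_append, List.cons.injEq, List.nil_append] at h
      obtain ⟨rfl, rfl⟩ := h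
      left
      simp [rep, rep_shift]

theorem rep3_shift (j : ℕ) (x : Fin 4) (l) (h : x :: l = rep [3] j) : l ++ [x] = rep [3] j := by
  cases j with
  | zero => simp [rep] at h
  | succ n =>
    simp only [rep, List.cons_append, List.cons.injEq, List.nil_append] at h
    obtain ⟨rfl, rfl⟩ := h
    rw [rep_succ']

open Classical in
/-- indicator of a predicate on words -/
noncomputable def ind (K : Type) [Field K] (P : List (Fin 4) → Prop) (l : List (Fin 4)) : K :=
  if P l then 1 else 0

theorem ind_congr {P Q : List (Fin 4) → Prop} {l m : List (Fin 4)} (h : P l ↔ Q m) :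
    ind K P l = ind K Q m := by
  by_cases hp : P l
  · simp [ind, hp, h.1 hp]
  · have hq : ¬ Q m := fun h' => hp (h.2 h')
    simp [ind, hp, hq]

theorem ind_false {P : List (Fin 4) → Prop} {l : List (Fin 4)} (h : ¬ P l) :
    ind K P l = 0 := by
  unfold ind; simp [h]

theorem ind_true {P : List (Fin 4) → Prop} {l : List (Fin 4)} (h : P l) :
    ind K P l = 1 := by
  unfold ind; simp [h]

theorem lemA {x y z x' y' z' : Fin 4} {n : ℕ} {w} (hn : 1 ≤ n)
    (h : rep [x, y, z] n ++ [x, y] ++ w = rep [x', y', z'] (n + 1)) : w = [z] := by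
  have h' := h
  obtain ⟨n, rfl⟩ : ∃ m, n = m + 1 := ⟨n - 1, by omega⟩
  simp only [rep, List.cons_append, List.cons.injEq, List.nil_append] at h
  obtain ⟨rfl, rfl, rfl, -⟩ := h
  rw [rep_succ' _ (n + 1), List.append_assoc, List.append_right_inj] at h'
  simp only [List.cons_append, List.cons.injEq, List.nil_append, true_and] at h'
  exact h'

theorem cycR_bad {m : ℕ} (w) : ¬ cycR m ([1, 3] ++ w) ∧ ¬ cycR m ([3, 2] ++ w) ∧
    ¬ cycR m ([0, 0] ++ w) ∧ ¬ cycR m ([2, 1] ++ w) ∧ ¬ cycR m ([2, 0, 0] ++ w) ∧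
    ¬ cycR m (3 :: w) := by
  cases m with
  | zero => simp [cycR, rep]
  | succ n => simp [cycR, rep]

theorem cycR_long {x y z : Fin 4} {m k : ℕ} (w) (hmk : m < k) :
    ¬ cycR m (rep [x, y, z] (k - 1) ++ [x, y] ++ w) ∧ ¬ cycR m (rep [x, y, z] k ++ w) := by
  constructor <;>
  · rintro (h | h | h) <;>
    · have := congrArg List.length h
      simp [rep_len] at this
      omega

/-- the kind of trace form we use -/
def TraceData (k s : ℕ) (a c : K) (v1 v2 va : K) (ve vx : ℕ → K) : Prop :=
  ∃ F : Aa K k s a c →ₗ[K] K, (∀ z ∈ comm K k s a c, F z = 0) ∧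
      F (E1 K k s a c) = v1 ∧ F (E2 K k s a c) = v2 ∧
      F (Al K k s a c ^ 2) = va ∧
      (∀ n, 1 ≤ n → F (Et K k s a c ^ n) = ve n) ∧
      (∀ n, 1 ≤ n → F ((Be K k s a c * Ga K k s a c * Al K k s a c) ^ n) = vx n)

theorem rep_inj (l : List (Fin 4)) (hl : l ≠ []) (m n : ℕ) : rep l m = rep l n ↔ m = n := by
  constructor
  · intro h
    have := congrArg List.length h
    have h0 : 0 < l.length := List.length_pos_iff.2 hl
    rw [rep_len, rep_len] at this
    exact Nat.eq_of_mul_eq_mul_right h0 this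
  · rintro rfl; rfl

theorem cycR_rep (m n : ℕ) (hn : 1 ≤ n) : cycR m (rep [1, 2, 0] n) ↔ n = m := by
  constructor
  · rintro (h | h | h) <;>
    · have := congrArg List.length h
      simp [rep_len] at this
      omega
  · rintro rfl; right; left; rfl

theorem trX (hk : 2 ≤ k) (hs : 3 ≤ s) (m : ℕ) (hm : 1 ≤ m) (hmk : m < k) :
    TraceData k s a c 0 0 0 (fun _ => 0) (fun n => if n = m then 1 else 0) := by
  obtain ⟨F, h0, h1, h2, h3, h4, h5⟩ := word_trace (k := k) (s := s) (a := a) (c := c) hk hs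
    (ind K (cycR m))
    (fun l l' => ind_congr (cyc_of_shift _ (cycR_shift m) l l'))
    (fun w => by rw [ind_false (cycR_bad w).1, ind_false (cycR_long w hmk).1])
    (fun w => by rw [ind_false (cycR_bad w).2.1, ind_false (cycR_long w hmk).1])
    (fun w => by rw [ind_false (cycR_bad w).2.2.1, ind_false (cycR_long w hmk).1,
      ind_false (cycR_long w hmk).2]; simp)
    (fun w => by
      obtain ⟨n, rfl⟩ : ∃ n, s = n + 2 := ⟨s - 2, by omega⟩
      rw [ind_false (cycR_bad w).2.2.2.1]
      symm
      exact ind_false (cycR_bad _).2.2.2.2.2)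
    (fun w => ind_false (cycR_bad (1 :: w)).2.2.1)
    (fun w => ind_false (cycR_bad w).2.2.2.2.1)
  have hnil : ind K (cycR m) [] = 0 := by
    apply ind_false
    obtain ⟨n, rfl⟩ : ∃ n, m = n + 1 := ⟨m - 1, by omega⟩
    simp [cycR, rep]
  refine ⟨F, h0, h1.trans hnil, h2.trans hnil, h3.trans ?_, ?_, ?_⟩
  · exact ind_false (cycR_bad []).2.2.1
  · intro n hn
    rw [h4 n hn]
    obtain ⟨n, rfl⟩ : ∃ m, n = m + 1 := ⟨n - 1, by omega⟩
    exact ind_false (cycR_bad _).2.2.2.2.2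
  · intro n hn
    rw [h5 n hn]
    simp only [ind, cycR_rep m n hn]

/-- words for the eta trace -/
def etaR (s j : ℕ) (l : List (Fin 4)) : Prop :=
  l = rep [3] j ∨ (j = s - 1 ∧ (l = [1, 2] ∨ l = [2, 1]))

theorem trEta (hk : 2 ≤ k) (hs : 3 ≤ s) (j : ℕ) (hj : 1 ≤ j) (hjs : j < s) :
    TraceData k s a c 0 0 0 (fun n => if n = j then 1 else 0) (fun _ => 0) := by
  obtain ⟨i, hi⟩ : ∃ n, j = n + 1 := ⟨j - 1, by omega⟩
  obtain ⟨p, hp⟩ : ∃ n, k - 1 = n + 1 := ⟨k - 2, by omega⟩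
  obtain ⟨p', hp'⟩ : ∃ n, k = n + 1 := ⟨k - 1, by omega⟩
  obtain ⟨F, h0, h1, h2, h3, h4, h5⟩ := word_trace (k := k) (s := s) (a := a) (c := c) hk hs
    (ind K (etaR s j))
    (fun l l' => ind_congr (cyc_of_shift _ (by
      rintro x l (h | ⟨hj, h | h⟩)
      · left; exact rep3_shift j x l h
      · simp only [List.cons.injEq] at h
        obtain ⟨rfl, rfl⟩ := h
        right; exact ⟨hj, Or.inr rfl⟩
      · simp only [List.cons.injEq] at h
        obtain ⟨rfl, rfl⟩ := h
        right; exact ⟨hj, Or.inl rfl⟩) l l'))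
    (fun w => by
      rw [ind_false (by simp [etaR, hi, rep]), ind_false (by simp [etaR, hi, rep, hp])])
    (fun w => by
      rw [ind_false, ind_false (by simp [etaR, hi, rep, hp])]
      simp only [etaR, hi, rep]
      cases i <;> simp [rep])
    (fun w => by
      rw [ind_false (by simp [etaR, hi, rep]), ind_false (by simp [etaR, hi, rep, hp]),
        ind_false]
      · simp
      rw [hp']
      simp [etaR, hi, rep])
    (fun w => by
      apply ind_congr
      constructor
      · rintro (h | ⟨hj, h | h⟩)
        · simp [hi, rep] at h
        · simp at h
        · left
          simp at h
          simp [hj, h]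
      · rintro (h | ⟨hj, h | h⟩)
        · have := congrArg List.length h
          simp [rep_len] at this
          right
          refine ⟨by omega, Or.inr ?_⟩
          have : w.length = 0 := by omega
          simp [List.length_eq_zero_iff.1 this]
        · rw [← hj, hi] at h; simp [rep] at h
        · rw [← hj, hi] at h; simp [rep] at h)
    (fun w => by rw [ind_false (by simp [etaR, hi, rep])])
    (fun w => by rw [ind_false (by simp [etaR, hi, rep])])
  have hnil : ind K (etaR s j) [] = 0 := by
    apply ind_false
    simp [etaR, hi, rep]
  refine ⟨F, h0, h1.trans hnil, h2.trans hnil, h3.trans ?_, ?_, ?_⟩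
  · exact ind_false (by simp [etaR, hi, rep])
  · intro n hn
    rw [h4 n hn]
    have : etaR s j (rep [3] n) ↔ n = j := by
      rw [etaR, rep_inj _ (by simp)]
      obtain ⟨n, rfl⟩ : ∃ m, n = m + 1 := ⟨n - 1, by omega⟩
      simp [rep]
    simp only [ind, this]
  · intro n hn
    rw [h5 n hn]
    obtain ⟨n, rfl⟩ : ∃ m, n = m + 1 := ⟨n - 1, by omega⟩
    exact ind_false (by simp [etaR, hi, rep])

/-- words for the socle trace -/
def socR (k s : ℕ) (l : List (Fin 4)) : Prop :=
  cycR k l ∨ l = rep [3] s ∨ l = [1, 3, 2] ∨ l = [3, 2, 1] ∨ l = [2, 1, 3]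

theorem socR_shift (x l) (h : socR k s (x :: l)) : socR k s (l ++ [x]) := by
  rcases h with h | h | h | h | h
  · exact Or.inl (cycR_shift _ _ _ h)
  · exact Or.inr (Or.inl (rep3_shift _ _ _ h))
  all_goals
    simp only [List.cons.injEq] at h
    obtain ⟨rfl, rfl⟩ := h
    simp [socR]

theorem trSoc (hk : 2 ≤ k) (hs : 3 ≤ s) :
    TraceData k s a c 0 0 c (fun n => if n = s then 1 else 0) (fun n => if n = k then 1 else 0) := by
  obtain ⟨t, ht⟩ : ∃ n, s = n + 3 := ⟨s - 3, by omega⟩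
  obtain ⟨p, hp⟩ : ∃ n, k - 1 = n + 1 := ⟨k - 2, by omega⟩
  obtain ⟨p', hp'⟩ : ∃ n, k = n + 1 := ⟨k - 1, by omega⟩
  obtain ⟨q, hq⟩ : ∃ n, k = n + 2 := ⟨k - 2, by omega⟩
  have hs' : s - 1 = t + 2 := by omega
  obtain ⟨F, h0, h1, h2, h3, h4, h5⟩ := word_trace (k := k) (s := s) (a := a) (c := c) hk hs
    (fun l => ind K (socR k s) l + (a * ind K (· = [0, 0, 0]) l + c * ind K (· = [0, 0]) l))
    (fun l l' => by
      rw [ind_congr (cyc_of_shift _ socR_shift l l'),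
        ind_congr (P := (· = [0, 0, 0])) (Q := (· = [0, 0, 0])) (cyc_of_shift (· = [0, 0, 0]) (by
          intro x l h; simp only [List.cons.injEq] at h; obtain ⟨rfl, rfl⟩ := h; rfl) l l'),
        ind_congr (P := (· = [0, 0])) (Q := (· = [0, 0])) (cyc_of_shift (· = [0, 0]) (by
          intro x l h; simp only [List.cons.injEq] at h; obtain ⟨rfl, rfl⟩ := h; rfl) l l')])
    (fun w => by
      rw [ind_false (P := (· = [0, 0, 0])) (by simp), ind_false (P := (· = [0, 0])) (by simp),
        ind_false (P := (· = [0, 0, 0])) (by simp [hp, rep]),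
        ind_false (P := (· = [0, 0])) (by simp [hp, rep])]
      congr 1
      apply ind_congr
      trans w = [2]
      · constructor
        · rintro (h | h)
          · exact absurd h (cycR_bad w).1
          · simpa [ht, rep] using h
        · rintro rfl; simp [socR]
      · constructor
        · rintro rfl
          left; left
          rw [hp', rep_succ']; simp
        · rintro (h | h)
          · rw [hq] at h
            rcases h with h | h | h <;> exact lemA (by omega) h
          · simp [ht, rep, hp] at h)
    (fun w => by
      rw [ind_false (P := (· = [0, 0, 0])) (by simp), ind_false (P := (· = [0, 0])) (by simp),
        ind_false (P := (· = [0, 0, 0])) (by simp [hp, rep]),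
        ind_false (P := (· = [0, 0])) (by simp [hp, rep])]
      congr 1
      apply ind_congr
      trans w = [1]
      · constructor
        · rintro (h | h)
          · exact absurd h (cycR_bad w).2.1
          · simpa [ht, rep] using h
        · rintro rfl; simp [socR]
      · constructor
        · rintro rfl
          left; right; right
          rw [hp', rep_succ']; simp
        · rintro (h | h)
          · rw [hq] at h
            rcases h with h | h | h <;> exact lemA (by omega) h
          · simp [ht, rep, hp] at h)
    (fun w => by
      rw [ind_false (P := (· = [0, 0, 0])) (l := rep [1, 2, 0] (k - 1) ++ [1, 2] ++ w)
          (by simp [hp, rep]),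
        ind_false (P := (· = [0, 0])) (l := rep [1, 2, 0] (k - 1) ++ [1, 2] ++ w)
          (by simp [hp, rep]),
        ind_false (P := (· = [0, 0, 0])) (l := rep [1, 2, 0] k ++ w) (by simp [hq, rep]),
        ind_false (P := (· = [0, 0])) (l := rep [1, 2, 0] k ++ w) (by simp [hq, rep]),
        ind_false (P := socR k s) (l := [0, 0] ++ w)]
      · have e1 : ind K (· = [0, 0, 0]) ([0, 0] ++ w) =
            ind K (socR k s) (rep [1, 2, 0] (k - 1) ++ [1, 2] ++ w) := by
          apply ind_congr
          trans w = [0]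
          · simp
          constructor
          · rintro rfl
            left; right; left
            rw [hp', rep_succ']; simp
          · rintro (h | h)
            · rw [hq] at h
              rcases h with h | h | h <;> exact lemA (by omega) h
            · simp [ht, rep, hp] at h
        have e2 : ind K (· = [0, 0]) ([0, 0] ++ w) = ind K (socR k s) (rep [1, 2, 0] k ++ w) := by
          apply ind_congr
          trans w = []
          · simp
          constructor
          · rintro rfl
            left; right; left
            simp
          · rintro (h | h)
            · rcases h with h | h | h <;>
              · have := congrArg List.length h
                simp [rep_len] at this
                exact this
            · simp [ht, rep, hq] at h
        rw [e1, e2]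
        ring
      · rintro (h | h)
        · exact absurd h (cycR_bad w).2.2.1
        · simp [ht, rep] at h)
    (fun w => by
      rw [ind_false (P := (· = [0, 0, 0])) (by simp), ind_false (P := (· = [0, 0])) (by simp),
        ind_false (P := (· = [0, 0, 0])) (by simp [hs', rep]),
        ind_false (P := (· = [0, 0])) (by simp [hs', rep])]
      congr 1
      apply ind_congr
      trans w = [3]
      · constructor
        · rintro (h | h)
          · exact absurd h (cycR_bad w).2.2.2.1
          · simpa [ht, rep] using h
        · rintro rfl; simp [socR]
      · constructor
        · rintro rfl
          right; left
          rw [hs', ht, ← rep_succ']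
        · rw [hs']
          rintro (h | h | h)
          · exact absurd h (cycR_bad _).2.2.2.2.2
          · rw [ht, rep_succ' [3] (t + 2), List.append_right_inj] at h
            exact h
          · simp [rep] at h)
    (fun w => by
      rw [ind_false (P := (· = [0, 0, 0])) (by simp), ind_false (P := (· = [0, 0])) (by simp),
        ind_false]
      · simp
      · rintro (h | h)
        · exact absurd h (cycR_bad (1 :: w)).2.2.1
        · simp [ht, rep] at h)
    (fun w => by
      rw [ind_false (P := (· = [0, 0, 0])) (by simp), ind_false (P := (· = [0, 0])) (by simp),
        ind_false]
      · simp
      · rintro (h | h)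
        · exact absurd h (cycR_bad w).2.2.2.2.1
        · simp [ht, rep] at h)
  have hnil : ind K (socR k s) [] = 0 := ind_false (by simp [socR, cycR, hq, ht, rep])
  have hnil1 : ind K (· = [0, 0, 0]) [] = 0 := ind_false (by simp)
  have hnil2 : ind K (· = [0, 0]) [] = 0 := ind_false (by simp)
  rw [hnil, hnil1, hnil2] at h1 h2
  refine ⟨F, h0, by simpa using h1, by simpa using h2, h3.trans ?_, ?_, ?_⟩
  · rw [ind_false (P := socR k s) (by simp [socR, cycR, hq, ht, rep]),
      ind_false (P := (· = [0, 0, 0])) (by simp), ind_true (P := (· = [0, 0])) rfl]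
    simp
  · intro n hn
    rw [h4 n hn]
    obtain ⟨m, hm⟩ : ∃ m, n = m + 1 := ⟨n - 1, by omega⟩
    have : socR k s (rep [3] n) ↔ n = s := by
      rw [← rep_inj [3] (by simp)]
      constructor
      · rintro (h | h | h)
        · rw [hm] at h
          exact absurd h (cycR_bad _).2.2.2.2.2
        · exact h
        · rw [hm] at h
          cases m <;> simp [rep] at h
      · intro h; right; left; exact h
    rw [ind_false (P := (· = [0, 0, 0])) (by simp [hm, rep]),
      ind_false (P := (· = [0, 0])) (by simp [hm, rep])]
    simp [ind, this]
  · intro n hn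
    rw [h5 n hn]
    obtain ⟨m, hm⟩ : ∃ m, n = m + 1 := ⟨n - 1, by omega⟩
    have : socR k s (rep [1, 2, 0] n) ↔ n = k := by
      rw [← cycR_rep k n hn]
      constructor
      · rintro (h | h)
        · exact h
        · simp [hm, rep, ht] at h
      · intro h; left; exact h
    rw [ind_false (P := (· = [0, 0, 0])) (by simp [hm, rep]),
      ind_false (P := (· = [0, 0])) (by simp [hm, rep])]
    simp [ind, this]

theorem trE (hk : 2 ≤ k) (hs : 3 ≤ s) (v1 v2 : K) (hv1 : v1 * v1 = v1) (hv2 : v2 * v2 = v2)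
    (h12 : v1 * v2 = 0) (hsum : v1 + v2 = 1) :
    TraceData k s a c v1 v2 0 (fun _ => 0) (fun _ => 0) := by
  let χ : FreeAlgebra K Gen →ₐ[K] K := FreeAlgebra.lift K (fun g => match g with
    | e1 => v1 | e2 => v2 | al => 0 | be => 0 | ga => 0 | et => 0)
  have c1 : χ (gen K e1) = v1 := by simp [χ, gen]
  have c2 : χ (gen K e2) = v2 := by simp [χ, gen]
  have c3 : χ (gen K al) = 0 := by simp [χ, gen]
  have c4 : χ (gen K be) = 0 := by simp [χ, gen]
  have c5 : χ (gen K ga) = 0 := by simp [χ, gen]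
  have c6 : χ (gen K et) = 0 := by simp [χ, gen]
  obtain ⟨F, hF, h0⟩ := descend (k := k) (s := s) (a := a) (c := c) χ.toLinearMap
    (fun x y => by simp [mul_comm])
    (fun x y h w => by
      have h21 : v2 * v1 = 0 := by rw [mul_comm]; exact h12
      have hk0 : k ≠ 0 := by omega
      have hs0 : s - 1 ≠ 0 := by omega
      simp only [AlgHom.toLinearMap_apply, map_mul]
      congr 1
      cases h <;> simp [c1, c2, c3, c4, c5, c6, hv1, hv2, h12, h21, hsum, hk0, hs0])
  refine ⟨F, h0, ?_, ?_, ?_, ?_, ?_⟩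
  · rw [E1, hF]; exact c1
  · rw [E2, hF]; exact c2
  · rw [Al, ← map_pow, hF]; simp [c3]
  · intro n hn
    rw [Et, ← map_pow, hF]; simp [c6]; omega
  · intro n hn
    rw [Be, Ga, Al, ← map_mul, ← map_mul, ← map_pow, hF]; simp [c3]; omega

end traces
end QT
namespace QT
section algebra

/-- the relations in a general algebra -/
structure Rels {K R : Type} [Field K] [Ring R] [Algebra K R] (k s : ℕ) (a c : K)
    (e f α β γ η : R) : Prop where
  ef : e * f = 0
  fe : f * e = 0
  ee : e * e = e
  ff : f * f = f
  sum : e + f = 1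
  ea : e * α = α
  ae : α * e = α
  eb : e * β = β
  bf : β * f = β
  fg : f * γ = γ
  ge : γ * e = γ
  fh : f * η = η
  hf : η * f = η
  be : β * η = (α * β * γ) ^ (k - 1) * (α * β)
  hg : η * γ = (γ * α * β) ^ (k - 1) * (γ * α)
  aa : α * α = a • ((β * γ * α) ^ (k - 1) * (β * γ)) + c • (β * γ * α) ^ k
  gb : γ * β = η ^ (s - 1)
  aab : α * α * β = 0
  gaa : γ * (α * α) = 0

variable {K R : Type} [Field K] [Ring R] [Algebra K R] {k s : ℕ} {a c : K} {e f α β γ η : R}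

namespace Rels
variable (H : Rels k s a c e f α β γ η)
include H

theorem af : α * f = 0 := by rw [← H.ae, mul_assoc, H.ef, mul_zero]
theorem fa : f * α = 0 := by rw [← H.ea, ← mul_assoc, H.fe, zero_mul]
theorem be' : β * e = 0 := by rw [← H.bf, mul_assoc, H.fe, mul_zero]
theorem fb : f * β = 0 := by rw [← H.eb, ← mul_assoc, H.fe, zero_mul]
theorem gf : γ * f = 0 := by rw [← H.ge, mul_assoc, H.ef, mul_zero]
theorem eg : e * γ = 0 := by rw [← H.fg, ← mul_assoc, H.ef, zero_mul]
theorem he : η * e = 0 := by rw [← H.hf, mul_assoc, H.fe, mul_zero]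
theorem eh : e * η = 0 := by rw [← H.fh, ← mul_assoc, H.ef, zero_mul]
theorem ag : α * γ = 0 := by rw [← H.ae, mul_assoc, H.eg, mul_zero]
theorem ah : α * η = 0 := by rw [← H.ae, mul_assoc, H.eh, mul_zero]
theorem ba : β * α = 0 := by rw [← H.bf, mul_assoc, H.fa, mul_zero]
theorem bb : β * β = 0 := by
  have h : β * f * β = 0 := by rw [mul_assoc, H.fb, mul_zero]
  rwa [H.bf] at h
theorem gg : γ * γ = 0 := by
  have h : γ * e * γ = 0 := by rw [mul_assoc, H.eg, mul_zero]
  rwa [H.ge] at h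
theorem gh : γ * η = 0 := by rw [← H.ge, mul_assoc, H.eh, mul_zero]
theorem ha : η * α = 0 := by rw [← H.hf, mul_assoc, H.fa, mul_zero]
theorem hb : η * β = 0 := by rw [← H.hf, mul_assoc, H.fb, mul_zero]

theorem aab' : α * (α * β) = 0 := by rw [← mul_assoc, H.aab]

theorem abh (hk : 2 ≤ k) : α * (β * η) = 0 := by
  obtain ⟨n, hn⟩ : ∃ n, k - 1 = n + 1 := ⟨k - 2, by omega⟩
  rw [H.be, hn, pow_succ']
  simp only [← mul_assoc, H.aab, zero_mul]

theorem hga : η * γ * α = 0 := by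
  rw [H.hg, mul_assoc (_ ^ _), mul_assoc γ α α, H.gaa, mul_zero]

theorem bhh (hk : 2 ≤ k) : β * η * η = 0 := by
  rw [H.be, mul_assoc (_ ^ _), mul_assoc α β η, H.abh hk, mul_zero]

theorem hhg (hk : 2 ≤ k) : η * (η * γ) = 0 := by
  obtain ⟨n, hn⟩ : ∃ n, k - 1 = n + 1 := ⟨k - 2, by omega⟩
  rw [H.hg, hn, pow_succ']
  simp only [← mul_assoc, H.hga, zero_mul]

theorem bgb (hk : 2 ≤ k) (hs : 3 ≤ s) : β * (γ * β) = 0 := by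
  obtain ⟨n, hn⟩ : ∃ n, s - 1 = n + 2 := ⟨s - 3, by omega⟩
  rw [H.gb, hn, pow_succ', pow_succ', ← mul_assoc, ← mul_assoc, H.bhh hk, zero_mul]

theorem x_shift (n : ℕ) : β * (γ * α * β) ^ n = (β * γ * α) ^ n * β :=
  SemiconjBy.pow_right (show SemiconjBy β (γ * α * β) (β * γ * α) by
    simp [SemiconjBy, mul_assoc]) n

theorem p_shift (n : ℕ) : α * (β * γ * α) ^ n = (α * β * γ) ^ n * α :=
  SemiconjBy.pow_right (show SemiconjBy α (β * γ * α) (α * β * γ) by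
    simp [SemiconjBy, mul_assoc]) n

theorem q_shift (n : ℕ) : γ * (α * β * γ) ^ n = (γ * α * β) ^ n * γ :=
  SemiconjBy.pow_right (show SemiconjBy γ (α * β * γ) (γ * α * β) by
    simp [SemiconjBy, mul_assoc]) n

theorem hs_eq (hk : 2 ≤ k) (hs : 3 ≤ s) : η ^ s = (γ * α * β) ^ k := by
  obtain ⟨n, hn⟩ : ∃ n, s = n + 1 := ⟨s - 1, by omega⟩
  obtain ⟨m, hm⟩ : ∃ n, k = n + 1 := ⟨k - 1, by omega⟩
  have h1 : η ^ s = γ * (β * η) := by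
    rw [← mul_assoc, H.gb, hn, pow_succ]; rfl
  rw [h1, H.be, ← mul_assoc, H.q_shift, hm, pow_succ]
  simp [mul_assoc]

theorem hs1 (hk : 2 ≤ k) (hs : 3 ≤ s) (t : ℕ) (ht : s < t) : η ^ t = 0 := by
  obtain ⟨n, hn⟩ : ∃ n, s = n + 1 := ⟨s - 1, by omega⟩
  have h1 : η ^ s = γ * (β * η) := by
    rw [← mul_assoc, H.gb, hn, pow_succ]; rfl
  obtain ⟨r, hr⟩ : ∃ r, t = s + 1 + r := ⟨t - s - 1, by omega⟩
  rw [hr, pow_add, pow_succ, h1, mul_assoc γ, H.bhh hk, mul_zero, zero_mul]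

theorem xk1 (hk : 2 ≤ k) (hs : 3 ≤ s) (t : ℕ) (ht : k < t) : (β * γ * α) ^ t = 0 := by
  have h1 : (β * γ * α) ^ k * β = 0 := by
    obtain ⟨n, hn⟩ : ∃ n, s = n + 2 := ⟨s - 2, by omega⟩
    rw [← H.x_shift, ← H.hs_eq hk hs, hn, pow_succ', pow_succ', ← mul_assoc, ← mul_assoc,
      H.bhh hk, zero_mul]
  obtain ⟨r, hr⟩ : ∃ r, t = k + 1 + r := ⟨t - k - 1, by omega⟩
  rw [hr, pow_add, pow_succ, ← mul_assoc, ← mul_assoc, h1, zero_mul, zero_mul, zero_mul]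

end Rels

/-- the spanning words -/
inductive UU (e f α β γ η : R) : R → Prop
  | e : UU e f α β γ η e
  | f : UU e f α β γ η f
  | p1 (n : ℕ) : UU e f α β γ η ((α * β * γ) ^ n * α)
  | p2 (n : ℕ) : UU e f α β γ η ((α * β * γ) ^ n * α * β)
  | p3 (n : ℕ) : UU e f α β γ η ((α * β * γ) ^ n * α * β * γ)
  | x1 (n : ℕ) : UU e f α β γ η ((β * γ * α) ^ n * β)
  | x2 (n : ℕ) : UU e f α β γ η ((β * γ * α) ^ n * β * γ)
  | x3 (n : ℕ) : UU e f α β γ η ((β * γ * α) ^ n * β * γ * α)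
  | q1 (n : ℕ) : UU e f α β γ η ((γ * α * β) ^ n * γ)
  | q2 (n : ℕ) : UU e f α β γ η ((γ * α * β) ^ n * γ * α)
  | q3 (n : ℕ) : UU e f α β γ η ((γ * α * β) ^ n * γ * α * β)
  | h (n : ℕ) : UU e f α β γ η (η ^ n * η)

theorem pow3_succ (p q r : R) (n : ℕ) : (p * q * r) ^ n * p * q * r = (p * q * r) ^ (n + 1) := by
  rw [pow_succ]; simp only [mul_assoc]

/-- span of the words -/
def WW (K : Type) [Field K] [Algebra K R] (e f α β γ η : R) : Submodule K R :=
  Submodule.span K {u | UU e f α β γ η u}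

theorem WW_of {u : R} (h : UU e f α β γ η u) : u ∈ WW K e f α β γ η :=
  Submodule.subset_span h

theorem WW_right (H : Rels k s a c e f α β γ η) (hk : 2 ≤ k) (hs : 3 ≤ s) (g : R)
    (hg : g = e ∨ g = f ∨ g = α ∨ g = β ∨ g = γ ∨ g = η) (u : R)
    (hu : u ∈ WW K e f α β γ η) : u * g ∈ WW K e f α β γ η := by
  have Z : (0 : R) ∈ WW K e f α β γ η := Submodule.zero_mem _
  have za : ∀ y, y * α * f = 0 := fun y => by rw [mul_assoc, H.af, mul_zero]
  have zb : ∀ y, y * β * e = 0 := fun y => by rw [mul_assoc, H.be', mul_zero]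
  have zg : ∀ y, y * γ * f = 0 := fun y => by rw [mul_assoc, H.gf, mul_zero]
  have zh : ∀ y, y * η * e = 0 := fun y => by rw [mul_assoc, H.he, mul_zero]
  have ia : ∀ y, y * α * e = y * α := fun y => by rw [mul_assoc, H.ae]
  have ib : ∀ y, y * β * f = y * β := fun y => by rw [mul_assoc, H.bf]
  have ig : ∀ y, y * γ * e = y * γ := fun y => by rw [mul_assoc, H.ge]
  have ih : ∀ y, y * η * f = y * η := fun y => by rw [mul_assoc, H.hf]
  have zag : ∀ y, y * α * γ = 0 := fun y => by rw [mul_assoc, H.ag, mul_zero]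
  have zah : ∀ y, y * α * η = 0 := fun y => by rw [mul_assoc, H.ah, mul_zero]
  have zba : ∀ y, y * β * α = 0 := fun y => by rw [mul_assoc, H.ba, mul_zero]
  have zbb : ∀ y, y * β * β = 0 := fun y => by rw [mul_assoc, H.bb, mul_zero]
  have zgg : ∀ y, y * γ * γ = 0 := fun y => by rw [mul_assoc, H.gg, mul_zero]
  have zgh : ∀ y, y * γ * η = 0 := fun y => by rw [mul_assoc, H.gh, mul_zero]
  have zha : ∀ y, y * η * α = 0 := fun y => by rw [mul_assoc, H.ha, mul_zero]
  have zhb : ∀ y, y * η * β = 0 := fun y => by rw [mul_assoc, H.hb, mul_zero]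
  have zgaa : ∀ y, y * γ * α * α = 0 := fun y => by
    rw [mul_assoc, mul_assoc, H.gaa, mul_zero]
  have zbgb : ∀ y, y * β * γ * β = 0 := fun y => by
    rw [mul_assoc, mul_assoc, H.bgb hk hs, mul_zero]
  have zabh : ∀ y, y * α * β * η = 0 := fun y => by
    rw [mul_assoc, mul_assoc, H.abh hk, mul_zero]
  have zhhg : ∀ y, y * η * η * γ = 0 := fun y => by
    rw [mul_assoc, mul_assoc, H.hhg hk, mul_zero]
  unfold WW at hu
  induction hu using Submodule.span_induction with
  | zero => rw [zero_mul]; exact Z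
  | add x y _ _ hx hy => rw [add_mul]; exact Submodule.add_mem _ hx hy
  | smul r x _ hx => rw [smul_mul_assoc]; exact Submodule.smul_mem _ _ hx
  | mem u hu =>
    cases hu with
    | e =>
      rcases hg with rfl | rfl | rfl | rfl | rfl | rfl
      · rw [H.ee]; exact WW_of .e
      · rw [H.ef]; exact Z
      · rw [H.ea]; simpa using (WW_of (K := K) (.p1 0) : _ ∈ WW K e f g β γ η)
      · rw [H.eb]; simpa using (WW_of (K := K) (.x1 0) : _ ∈ WW K e f α g γ η)
      · rw [H.eg]; exact Z
      · rw [H.eh]; exact Z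
    | f =>
      rcases hg with rfl | rfl | rfl | rfl | rfl | rfl
      · rw [H.fe]; exact Z
      · rw [H.ff]; exact WW_of .f
      · rw [H.fa]; exact Z
      · rw [H.fb]; exact Z
      · rw [H.fg]; simpa using (WW_of (K := K) (.q1 0) : _ ∈ WW K e f α β g η)
      · rw [H.fh]; simpa using (WW_of (K := K) (.h 0) : _ ∈ WW K e f α β γ g)
    | p1 n =>
      rcases hg with rfl | rfl | rfl | rfl | rfl | rfl
      · rw [ia]; exact WW_of (.p1 n)
      · rw [za]; exact Z
      · cases n with
        | zero =>
          rw [pow_zero, one_mul, H.aa]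
          refine Submodule.add_mem _ (Submodule.smul_mem _ _ ?_) (Submodule.smul_mem _ _ ?_)
          · rw [← mul_assoc]; exact WW_of (.x2 _)
          · have h := WW_of (K := K) (.x3 (k - 1) : UU e f g β γ η _)
            rw [pow3_succ] at h
            rwa [show k - 1 + 1 = k by omega] at h
        | succ n => rw [← pow3_succ, zgaa]; exact Z
      · exact WW_of (.p2 n)
      · rw [zag]; exact Z
      · rw [zah]; exact Z
    | p2 n =>
      rcases hg with rfl | rfl | rfl | rfl | rfl | rfl
      · rw [zb]; exact Z
      · rw [ib]; exact WW_of (.p2 n)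
      · rw [zba]; exact Z
      · rw [zbb]; exact Z
      · exact WW_of (.p3 n)
      · rw [zabh]; exact Z
    | p3 n =>
      rcases hg with rfl | rfl | rfl | rfl | rfl | rfl
      · rw [ig]; exact WW_of (.p3 n)
      · rw [zg]; exact Z
      · rw [pow3_succ]; exact WW_of (.p1 (n + 1))
      · rw [zbgb]; exact Z
      · rw [zgg]; exact Z
      · rw [zgh]; exact Z
    | x1 n =>
      rcases hg with rfl | rfl | rfl | rfl | rfl | rfl
      · rw [zb]; exact Z
      · rw [ib]; exact WW_of (.x1 n)
      · rw [zba]; exact Z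
      · rw [zbb]; exact Z
      · exact WW_of (.x2 n)
      · cases n with
        | zero =>
          rw [pow_zero, one_mul, H.be, ← mul_assoc]
          exact WW_of (.p2 _)
        | succ n => rw [← pow3_succ, zabh]; exact Z
    | x2 n =>
      rcases hg with rfl | rfl | rfl | rfl | rfl | rfl
      · rw [ig]; exact WW_of (.x2 n)
      · rw [zg]; exact Z
      · exact WW_of (.x3 n)
      · rw [zbgb]; exact Z
      · rw [zgg]; exact Z
      · rw [zgh]; exact Z
    | x3 n =>
      rcases hg with rfl | rfl | rfl | rfl | rfl | rfl
      · rw [ia]; exact WW_of (.x3 n)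
      · rw [za]; exact Z
      · rw [zgaa]; exact Z
      · rw [pow3_succ]; exact WW_of (.x1 (n + 1))
      · rw [zag]; exact Z
      · rw [zah]; exact Z
    | q1 n =>
      rcases hg with rfl | rfl | rfl | rfl | rfl | rfl
      · rw [ig]; exact WW_of (.q1 n)
      · rw [zg]; exact Z
      · exact WW_of (.q2 n)
      · cases n with
        | zero =>
          rw [pow_zero, one_mul, H.gb, show s - 1 = (s - 2) + 1 by omega, pow_succ]
          exact WW_of (.h _)
        | succ n => rw [← pow3_succ, zbgb]; exact Z
      · rw [zgg]; exact Z
      · rw [zgh]; exact Z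
    | q2 n =>
      rcases hg with rfl | rfl | rfl | rfl | rfl | rfl
      · rw [ia]; exact WW_of (.q2 n)
      · rw [za]; exact Z
      · rw [zgaa]; exact Z
      · exact WW_of (.q3 n)
      · rw [zag]; exact Z
      · rw [zah]; exact Z
    | q3 n =>
      rcases hg with rfl | rfl | rfl | rfl | rfl | rfl
      · rw [zb]; exact Z
      · rw [ib]; exact WW_of (.q3 n)
      · rw [zba]; exact Z
      · rw [zbb]; exact Z
      · rw [pow3_succ]; exact WW_of (.q1 (n + 1))
      · rw [zabh]; exact Z
    | h n =>
      rcases hg with rfl | rfl | rfl | rfl | rfl | rfl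
      · rw [zh]; exact Z
      · rw [ih]; exact WW_of (.h n)
      · rw [zha]; exact Z
      · rw [zhb]; exact Z
      · cases n with
        | zero =>
          rw [pow_zero, one_mul, H.hg, ← mul_assoc]
          exact WW_of (.q2 _)
        | succ n => rw [pow_succ, zhhg]; exact Z
      · rw [← pow_succ]; exact WW_of (.h _)

/-- reduction of the words modulo commutators -/
theorem UU_mod (H : Rels k s a c e f α β γ η) (hk : 2 ≤ k) (hs : 3 ≤ s) (C S : Submodule K R)
    (hC : ∀ u v : R, u * v - v * u ∈ C) (hCS : C ≤ S)
    (se : e ∈ S) (sf : f ∈ S) (sa : α ∈ S) (sh : ∀ t, 1 ≤ t → t < s → η ^ t ∈ S)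
    (sx : ∀ m, 1 ≤ m → m ≤ k → (β * γ * α) ^ m ∈ S) (u : R) (hu : UU e f α β γ η u) : u ∈ S := by
  have cy : ∀ u v : R, v * u ∈ S → u * v ∈ S := fun u v h => by
    have := Submodule.add_mem _ (hCS (hC u v)) h
    simpa using this
  have ez : ∀ u : R, u * e = 0 → e * u = u → u ∈ S := fun u h1 h2 => by
    rw [← h2]; apply cy; rw [h1]; exact Submodule.zero_mem _
  have fz : ∀ u : R, u * f = 0 → f * u = u → u ∈ S := fun u h1 h2 => by
    rw [← h2]; apply cy; rw [h1]; exact Submodule.zero_mem _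
  have ez' : ∀ u : R, u * e = u → e * u = 0 → u ∈ S := fun u h1 h2 => by
    rw [← h1]; apply cy; rw [h2]; exact Submodule.zero_mem _
  have sx' : ∀ m, (β * γ * α) ^ (m + 1) ∈ S := by
    intro m
    by_cases h : m + 1 ≤ k
    · exact sx _ (by omega) h
    · rw [H.xk1 hk hs _ (by omega)]; exact Submodule.zero_mem _
  have sq' : ∀ m, (γ * α * β) ^ (m + 1) ∈ S := by
    intro m
    rw [← pow3_succ]
    apply cy
    rw [← mul_assoc, ← mul_assoc, H.x_shift, pow3_succ]
    exact sx' m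
  cases hu with
  | e => exact se
  | f => exact sf
  | p1 n =>
    cases n with
    | zero => simpa using sa
    | succ n =>
      apply cy
      rw [pow_succ', ← mul_assoc, ← mul_assoc, ← mul_assoc, H.aab, zero_mul, zero_mul]
      exact Submodule.zero_mem _
  | p2 n =>
    apply cy
    rw [← H.p_shift, ← mul_assoc, H.ba, zero_mul]
    exact Submodule.zero_mem _
  | p3 n =>
    rw [← H.p_shift, mul_assoc, mul_assoc]
    apply cy
    rw [← mul_assoc, pow3_succ]
    exact sx' n
  | x1 n =>
    rw [← H.x_shift]
    apply cy
    cases n with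
    | zero =>
      rw [pow_zero, one_mul]
      exact ez _ H.be' H.eb
    | succ n =>
      rw [← pow3_succ, mul_assoc _ β β, H.bb, mul_zero]; exact Submodule.zero_mem _
  | x2 n =>
    cases n with
    | zero =>
      rw [pow_zero, one_mul]
      apply cy
      rw [H.gb]
      exact sh _ (by omega) (by omega)
    | succ n =>
      rw [mul_assoc]
      apply cy
      have h0 : β * γ * β = 0 := by rw [mul_assoc, H.bgb hk hs]
      rw [pow_succ', ← mul_assoc, ← mul_assoc, ← mul_assoc, h0, zero_mul, zero_mul, zero_mul]
      exact Submodule.zero_mem _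
  | x3 n => rw [pow3_succ]; exact sx' n
  | q1 n =>
    rw [← H.q_shift]
    apply cy
    cases n with
    | zero =>
      rw [pow_zero, one_mul]
      exact fz _ H.gf H.fg
    | succ n =>
      rw [← pow3_succ, mul_assoc _ γ γ, H.gg, mul_zero]; exact Submodule.zero_mem _
  | q2 n =>
    rw [mul_assoc]
    apply ez'
    · rw [mul_assoc (_ ^ _), mul_assoc γ α e, H.ae]
    · cases n with
      | zero => rw [pow_zero, one_mul, ← mul_assoc, H.eg, zero_mul]
      | succ n =>
        rw [pow_succ']
        simp only [← mul_assoc, H.eg, zero_mul]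
  | q3 n => rw [pow3_succ]; exact sq' n
  | h n =>
    rw [← pow_succ]
    rcases lt_trichotomy (n + 1) s with h | h | h
    · exact sh _ (by omega) h
    · rw [h, H.hs_eq hk hs, show k = (k - 1) + 1 by omega]; exact sq' _
    · rw [H.hs1 hk hs _ h]; exact Submodule.zero_mem _
end algebra
end QT
namespace QT
theorem gen_id {R : Type} [Ring R] (u v : R) :
  (u * v - v * u) ^ 2 = (u * (v * u * v) - (v * u * v) * u)
      - (u * (v * v * u) - (v * v * u) * u) + (v * (v * u * u) - (v * u * u) * v)
      + ((v * u * v * u + v * u * v * u) - (v * v * u * u + v * v * u * u)) := by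
  simp only [pow_two, sub_mul, mul_sub, mul_assoc]
  abel

theorem gen_key {K R : Type} [Field K] [Ring R] [Algebra K R] (C : Submodule K R)
    {A E X Xk : R} {c μ ν ρ : K}
    (hsq : ∀ x y : R, (x + y) ^ 2 - (x ^ 2 + y ^ 2) ∈ C) (hA : A ^ 2 - c • Xk ∈ C)
    (hE : ν = 0 ∨ E ^ 2 - Xk ∈ C) (hX : X ^ 2 = Xk) (h : c * μ ^ 2 + ν ^ 2 + ρ ^ 2 = 0) :
    (μ • A + ν • E + ρ • X) ^ 2 ∈ C := by
  have h1 := hsq (μ • A + ν • E) (ρ • X)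
  have h2 := hsq (μ • A) (ν • E)
  have h3 := C.smul_mem (μ ^ 2) hA
  have h4 : ν ^ 2 • (E ^ 2 - Xk) ∈ C := by
    rcases hE with h | h
    · rw [h]; simp
    · exact C.smul_mem _ h
  have h6 : (c * μ ^ 2 + ν ^ 2 + ρ ^ 2) • Xk = 0 := by rw [h, zero_smul]
  have h7 := C.add_mem (C.add_mem h1 h2) (C.add_mem h3 h4)
  convert h7 using 1
  rw [← sub_eq_zero, ← h6]
  simp only [smul_pow, hX, add_smul, smul_sub, smul_smul]
  rw [mul_comm (μ ^ 2) c]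
  abel

section final
variable {K : Type} [Field K] {k s : ℕ} {a c : K}

theorem rels : Rels k s a c (E1 K k s a c) (E2 K k s a c) (Al K k s a c) (Be K k s a c)
    (Ga K k s a c) (Et K k s a c) := by
  have M : ∀ {x y}, Rel K k s a c x y → RingQuot.mkAlgHom K (Rel K k s a c) x =
    RingQuot.mkAlgHom K (Rel K k s a c) y := fun h => RingQuot.mkAlgHom_rel K h
  constructor
  · simpa [E1, E2, Al, Be, Ga, Et] using M .orth12
  · simpa [E1, E2, Al, Be, Ga, Et] using M .orth21
  · simpa [E1, E2, Al, Be, Ga, Et] using M .idem1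
  · simpa [E1, E2, Al, Be, Ga, Et] using M .idem2
  · simpa [E1, E2, Al, Be, Ga, Et] using M .sum_idem
  · simpa [E1, E2, Al, Be, Ga, Et] using M .al_left
  · simpa [E1, E2, Al, Be, Ga, Et] using M .al_right
  · simpa [E1, E2, Al, Be, Ga, Et] using M .be_left
  · simpa [E1, E2, Al, Be, Ga, Et] using M .be_right
  · simpa [E1, E2, Al, Be, Ga, Et] using M .ga_left
  · simpa [E1, E2, Al, Be, Ga, Et] using M .ga_right
  · simpa [E1, E2, Al, Be, Ga, Et] using M .et_left
  · simpa [E1, E2, Al, Be, Ga, Et] using M .et_right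
  · simpa [E1, E2, Al, Be, Ga, Et] using M .rel_beta_eta
  · simpa [E1, E2, Al, Be, Ga, Et] using M .rel_eta_gamma
  · simpa [E1, E2, Al, Be, Ga, Et] using M .rel_alpha_sq
  · simpa [E1, E2, Al, Be, Ga, Et] using M .rel_gamma_beta
  · simpa [E1, E2, Al, Be, Ga, Et] using M .rel_alpha_sq_beta
  · simpa [E1, E2, Al, Be, Ga, Et] using M .rel_gamma_alpha_sq

theorem WW_top (hk : 2 ≤ k) (hs : 3 ≤ s) (z : Aa K k s a c) :
    z ∈ WW K (E1 K k s a c) (E2 K k s a c) (Al K k s a c) (Be K k s a c)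
    (Ga K k s a c) (Et K k s a c) := by
  obtain ⟨y, rfl⟩ := RingQuot.mkAlgHom_surjective K (Rel K k s a c) z
  have key : ∀ u ∈ WW K (E1 K k s a c) (E2 K k s a c) (Al K k s a c) (Be K k s a c)
    (Ga K k s a c) (Et K k s a c), u * RingQuot.mkAlgHom K (Rel K k s a c) y ∈
      WW K (E1 K k s a c) (E2 K k s a c) (Al K k s a c) (Be K k s a c)
    (Ga K k s a c) (Et K k s a c) := by
    induction y using FreeAlgebra.induction with
    | grade0 r =>
      intro u hu
      rw [AlgHom.commutes, ← Algebra.commutes, ← Algebra.smul_def]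
      exact Submodule.smul_mem _ _ hu
    | grade1 g =>
      intro u hu
      refine WW_right rels hk hs _ ?_ u hu
      cases g
      · left; rfl
      · right; left; rfl
      · right; right; left; rfl
      · right; right; right; left; rfl
      · right; right; right; right; left; rfl
      · right; right; right; right; right; rfl
    | mul x y hx hy =>
      intro u hu
      rw [map_mul, ← mul_assoc]
      exact hy _ (hx _ hu)
    | add x y hx hy =>
      intro u hu
      rw [map_add, mul_add]
      exact Submodule.add_mem _ (hx _ hu) (hy _ hu)
  have h1 := key 1 (by
    rw [← (rels (K := K) (k := k) (s := s) (a := a) (c := c)).sum]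
    exact Submodule.add_mem _ (WW_of .e) (WW_of .f))
  simpa using h1

/-- the linear map of normal forms modulo commutators -/
noncomputable def LL (K : Type) [Field K] (k s : ℕ) (a c : K) :
    (K × K × K × (ℕ → K) × (ℕ → K)) →ₗ[K] Aa K k s a c where
  toFun v := v.1 • E1 K k s a c + v.2.1 • E2 K k s a c + v.2.2.1 • Al K k s a c
    + (∑ t ∈ Finset.Ico 1 s, v.2.2.2.1 t • Et K k s a c ^ t)
    + ∑ m ∈ Finset.Icc 1 k, v.2.2.2.2 m • (Be K k s a c * Ga K k s a c * Al K k s a c) ^ m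
  map_add' v w := by
    simp only [Prod.fst_add, Prod.snd_add, Pi.add_apply, add_smul, Finset.sum_add_distrib]
    abel
  map_smul' r v := by
    simp only [Prod.smul_fst, Prod.smul_snd, Pi.smul_apply, smul_eq_mul, mul_smul, smul_add,
      Finset.smul_sum, RingHom.id_apply]

theorem LL_apply (v : K × K × K × (ℕ → K) × (ℕ → K)) : LL K k s a c v =
    v.1 • E1 K k s a c + v.2.1 • E2 K k s a c + v.2.2.1 • Al K k s a c
    + (∑ t ∈ Finset.Ico 1 s, v.2.2.2.1 t • Et K k s a c ^ t)
    + ∑ m ∈ Finset.Icc 1 k, v.2.2.2.2 m • (Be K k s a c * Ga K k s a c * Al K k s a c) ^ m := rfl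

theorem comm_mem (u v : Aa K k s a c) : u * v - v * u ∈ comm K k s a c :=
  Submodule.subset_span ⟨u, v, rfl⟩

theorem normal_form (hk : 2 ≤ k) (hs : 3 ≤ s) (z : Aa K k s a c) :
    ∃ y ∈ comm K k s a c, ∃ v, y + LL K k s a c v = z := by
  have : z ∈ comm K k s a c ⊔ LinearMap.range (LL K k s a c) := by
    have hW := WW_top hk hs z
    have hle : WW K (E1 K k s a c) (E2 K k s a c) (Al K k s a c) (Be K k s a c)
        (Ga K k s a c) (Et K k s a c) ≤ comm K k s a c ⊔ LinearMap.range (LL K k s a c) := by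
      unfold WW
      rw [Submodule.span_le]
      intro u hu
      have R : ∀ v, LL K k s a c v ∈ comm K k s a c ⊔ LinearMap.range (LL K k s a c) :=
        fun v => Submodule.mem_sup_right ⟨v, rfl⟩
      refine UU_mod rels hk hs (comm K k s a c) _ comm_mem le_sup_left ?_ ?_ ?_ ?_ ?_ u hu
      · have := R (1, 0, 0, 0, 0)
        rw [LL_apply] at this
        simpa using this
      · have := R (0, 1, 0, 0, 0)
        rw [LL_apply] at this
        simpa using this
      · have := R (0, 0, 1, 0, 0)
        rw [LL_apply] at this
        simpa using this
      · intro t h1 h2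
        have := R (0, 0, 0, Pi.single t 1, 0)
        rw [LL_apply] at this
        rw [Finset.sum_eq_single t] at this
        · simpa using this
        · intro b _ hb; simp [Pi.single_eq_of_ne hb]
        · intro h; exact absurd (Finset.mem_Ico.2 ⟨h1, h2⟩) h
      · intro t h1 h2
        have := R (0, 0, 0, 0, Pi.single t 1)
        rw [LL_apply] at this
        rw [Finset.sum_eq_single t (s := Finset.Icc 1 k)] at this
        · simpa using this
        · intro b _ hb; simp [Pi.single_eq_of_ne hb]
        · intro h; exact absurd (Finset.mem_Icc.2 ⟨h1, h2⟩) h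
    exact hle hW
  obtain ⟨y, hy, w, ⟨v, rfl⟩, h⟩ := Submodule.mem_sup.1 this
  exact ⟨y, hy, v, h⟩

variable [CharP K 2]

theorem two_smul_zero (x : Aa K k s a c) : x + x = 0 := by
  rw [← two_smul K x, CharTwo.two_eq_zero, zero_smul]

theorem neg_self (x : Aa K k s a c) : -x = x := by
  rw [neg_eq_iff_add_eq_zero, two_smul_zero]

theorem sq_add_mem (x y : Aa K k s a c) :
    (x + y) ^ 2 - (x ^ 2 + y ^ 2) ∈ comm K k s a c := by
  have h : (x + y) ^ 2 - (x ^ 2 + y ^ 2) = x * y - y * x := by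
    rw [sub_eq_add_neg (x * y), neg_self]
    noncomm_ring
  rw [h]; exact comm_mem x y

/-- T1 as a submodule -/
noncomputable def TS (K : Type) [Field K] [CharP K 2] (k s : ℕ) (a c : K) :
    Submodule K (Aa K k s a c) where
  carrier := T1 K k s a c
  add_mem' := by
    intro x y hx hy
    have := Submodule.add_mem _ (sq_add_mem x y) (Submodule.add_mem _ hx hy)
    simpa [T1] using this
  zero_mem' := by simp [T1]
  smul_mem' := by
    intro r x hx
    simp only [T1, Set.mem_setOf_eq, smul_pow]
    exact Submodule.smul_mem _ _ hx

theorem mem_TS (z : Aa K k s a c) : z ∈ TS K k s a c ↔ z ^ 2 ∈ comm K k s a c := Iff.rfl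

theorem comm_le_TS : comm K k s a c ≤ TS K k s a c := by
  conv_lhs => unfold comm
  rw [Submodule.span_le]
  rintro _ ⟨u, v, rfl⟩
  rw [SetLike.mem_coe, mem_TS]
  have h : (u * v - v * u) ^ 2 = (u * (v * u * v) - (v * u * v) * u)
      - (u * (v * v * u) - (v * v * u) * u) + (v * (v * u * u) - (v * u * u) * v)
      + ((v * u * v * u + v * u * v * u) - (v * v * u * u + v * v * u * u)) := gen_id u v
  rw [h, two_smul_zero, two_smul_zero, sub_zero, add_zero]
  exact Submodule.add_mem _ (Submodule.sub_mem _ (comm_mem _ _) (comm_mem _ _)) (comm_mem _ _)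

theorem trace_sq {v1 v2 va : K} {ve vx : ℕ → K} (h : TraceData k s a c v1 v2 va ve vx)
    (y : Aa K k s a c) (hy : y ∈ comm K k s a c) (v : K × K × K × (ℕ → K) × (ℕ → K))
    (hz : (y + LL K k s a c v) ^ 2 ∈ comm K k s a c) :
    v.1 ^ 2 * v1 + v.2.1 ^ 2 * v2 + v.2.2.1 ^ 2 * va
      + (∑ t ∈ Finset.Ico 1 s, v.2.2.2.1 t ^ 2 * ve (2 * t))
      + ∑ m ∈ Finset.Icc 1 k, v.2.2.2.2 m ^ 2 * vx (2 * m) = 0 := by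
  obtain ⟨F, h0, h1, h2, h3, h4, h5⟩ := h
  let Q : Aa K k s a c →+ K :=
    { toFun := fun z => F (z ^ 2)
      map_zero' := by simp
      map_add' := by
        intro x y
        have := h0 _ (sq_add_mem x y)
        rw [map_sub, sub_eq_zero, map_add] at this
        exact this }
  have hQ : ∀ (r : K) x, Q (r • x) = r ^ 2 * F (x ^ 2) := by
    intro r x
    change F ((r • x) ^ 2) = _
    rw [smul_pow, map_smul, smul_eq_mul]
  have hL : Q (y + LL K k s a c v) = 0 := h0 _ hz
  have hy' : Q y = 0 := h0 _ (comm_le_TS hy)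
  rw [map_add, hy', zero_add] at hL
  simp only [LL, LinearMap.coe_mk, AddHom.coe_mk, map_add, map_sum, hQ] at hL
  rw [← hL, h3]
  have hR := rels (K := K) (k := k) (s := s) (a := a) (c := c)
  rw [pow_two (E1 K k s a c), pow_two (E2 K k s a c), hR.ee, hR.ff, h1, h2]
  congr 1
  · congr 1
    apply Finset.sum_congr rfl
    intro t ht
    rw [Finset.mem_Ico] at ht
    rw [← pow_mul, mul_comm t, h4 _ (by omega)]
  · apply Finset.sum_congr rfl
    intro t ht
    rw [Finset.mem_Icc] at ht
    rw [← pow_mul, mul_comm t, h5 _ (by omega)]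

/-- the base part -/
noncomputable def DD (K : Type) [Field K] (k s : ℕ) (a c : K) : Submodule K (Aa K k s a c) :=
  comm K k s a c ⊔ Submodule.span K (etaAbove K k s a c s ∪ cycAbove K k s a c k)

theorem al_sq (hk : 2 ≤ k) (hs : 3 ≤ s) :
    Al K k s a c ^ 2 - c • (Be K k s a c * Ga K k s a c * Al K k s a c) ^ k ∈ comm K k s a c := by
  have H := rels (K := K) (k := k) (s := s) (a := a) (c := c)
  rw [pow_two, H.aa, add_sub_cancel_right]
  apply Submodule.smul_mem
  obtain ⟨n, hn⟩ : ∃ n, k - 1 = n + 1 := ⟨k - 2, by omega⟩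
  have h0 : Be K k s a c * Ga K k s a c * Be K k s a c = 0 := by rw [mul_assoc, H.bgb hk hs]
  have h := comm_mem ((Be K k s a c * Ga K k s a c * Al K k s a c) ^ (k - 1))
    (Be K k s a c * Ga K k s a c)
  have h2 : Be K k s a c * Ga K k s a c *
      (Be K k s a c * Ga K k s a c * Al K k s a c) ^ (k - 1) = 0 := by
    rw [hn, pow_succ', ← mul_assoc, ← mul_assoc, ← mul_assoc, h0]
    simp only [zero_mul]
  rwa [h2, sub_zero] at h

theorem eta_s (hk : 2 ≤ k) (hs : 3 ≤ s) :
    Et K k s a c ^ s - (Be K k s a c * Ga K k s a c * Al K k s a c) ^ k ∈ comm K k s a c := by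
  have H := rels (K := K) (k := k) (s := s) (a := a) (c := c)
  obtain ⟨n, hn⟩ : ∃ n, k = n + 1 := ⟨k - 1, by omega⟩
  have e1 : Et K k s a c ^ s =
      ((Ga K k s a c * Al K k s a c * Be K k s a c) ^ n * Ga K k s a c * Al K k s a c)
        * Be K k s a c := by
    rw [H.hs_eq hk hs, pow3_succ, hn]
  have e2 : (Be K k s a c * Ga K k s a c * Al K k s a c) ^ k = Be K k s a c *
      ((Ga K k s a c * Al K k s a c * Be K k s a c) ^ n * Ga K k s a c * Al K k s a c) := by
    rw [← mul_assoc, ← mul_assoc, H.x_shift, pow3_succ, hn]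
  rw [e1, e2]
  exact comm_mem _ _

theorem DD_le (hk : 2 ≤ k) (hs : 3 ≤ s) : DD K k s a c ≤ TS K k s a c := by
  have H := rels (K := K) (k := k) (s := s) (a := a) (c := c)
  refine sup_le comm_le_TS (Submodule.span_le.2 ?_)
  rintro z (⟨t, h1, h2, rfl⟩ | ⟨t, h1, h2, rfl⟩)
  · rw [SetLike.mem_coe, mem_TS, ← pow_mul, H.hs1 hk hs _ (by omega)]
    exact Submodule.zero_mem _
  · rw [SetLike.mem_coe, mem_TS, ← pow_mul, H.xk1 hk hs _ (by omega)]
    exact Submodule.zero_mem _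

theorem key_mpr (hk : 2 ≤ k) (hke : Even k) (hs : 3 ≤ s) (μ ν ρ : K) (hν : Odd s → ν = 0)
    (h : c * μ ^ 2 + ν ^ 2 + ρ ^ 2 = 0) :
    μ • Al K k s a c + ν • Et K k s a c ^ (s / 2) +
      ρ • (Be K k s a c * Ga K k s a c * Al K k s a c) ^ (k / 2) ∈ TS K k s a c := by
  rw [mem_TS]
  refine gen_key (comm K k s a c) sq_add_mem (al_sq hk hs) ?_ ?_ h
  · rcases Nat.even_or_odd s with hse | hso
    · right
      rw [← pow_mul, Nat.div_mul_cancel hse.two_dvd]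
      exact eta_s hk hs
    · exact Or.inl (hν hso)
  · rw [← pow_mul, Nat.div_mul_cancel hke.two_dvd]

theorem key_mp (hk : 2 ≤ k) (hke : Even k) (hs : 3 ≤ s) (z : Aa K k s a c)
    (hz : z ∈ TS K k s a c) : ∃ μ ν ρ : K, (Odd s → ν = 0) ∧ c * μ ^ 2 + ν ^ 2 + ρ ^ 2 = 0 ∧
    ∃ y ∈ DD K k s a c, z = μ • Al K k s a c + ν • Et K k s a c ^ (s / 2) +
      ρ • (Be K k s a c * Ga K k s a c * Al K k s a c) ^ (k / 2) + y := by
  obtain ⟨y, hy, v, rfl⟩ := normal_form hk hs z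
  rw [mem_TS] at hz
  have t1 := trace_sq (trE hk hs 1 0 (by simp) (by simp) (by simp) (by simp)) y hy v hz
  have t2 := trace_sq (trE hk hs 0 1 (by simp) (by simp) (by simp) (by simp)) y hy v hz
  have t3 := fun j hj hjs => trace_sq (trEta hk hs j hj hjs) y hy v hz
  have t4 := fun j hj hjs => trace_sq (trX hk hs j hj hjs) y hy v hz
  have t5 := trace_sq (trSoc hk hs) y hy v hz
  obtain ⟨l1, l2, μ, ν, ρ⟩ := v
  simp at t1 t2
  subst t1 t2
  have n0 : ∀ t, 1 ≤ t → 2 * t < s → ν t = 0 := by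
    intro t ht1 ht2
    have := t3 (2 * t) (by omega) ht2
    simp only [mul_zero, Finset.sum_const_zero, add_zero, zero_add] at this
    rw [Finset.sum_eq_single t] at this
    · simpa using this
    · intro b _ hb
      rw [if_neg (by omega), mul_zero]
    · intro h
      exact absurd (Finset.mem_Ico.2 ⟨ht1, by omega⟩) h
  have r0 : ∀ t, 1 ≤ t → 2 * t < k → ρ t = 0 := by
    intro t ht1 ht2
    have := t4 (2 * t) (by omega) ht2
    simp only [mul_zero, Finset.sum_const_zero, add_zero, zero_add] at this
    rw [Finset.sum_eq_single t] at this
    · simpa using this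
    · intro b _ hb
      rw [if_neg (by omega), mul_zero]
    · intro h
      exact absurd (Finset.mem_Icc.2 ⟨ht1, by omega⟩) h
  have hk2 : 2 * (k / 2) = k := by rw [Nat.two_mul_div_two_of_even hke]
  have sumX : ∀ g : ℕ → K, (∑ m ∈ Finset.Icc 1 k, g m * (if 2 * m = k then 1 else 0)) = g (k / 2) := by
    intro g
    rw [Finset.sum_eq_single (k / 2)]
    · rw [if_pos hk2, mul_one]
    · intro b _ hb
      rw [if_neg (by omega), mul_zero]
    · intro h
      exact absurd (Finset.mem_Icc.2 ⟨by omega, by omega⟩) h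
  have etaD : ∀ t, s < 2 * t → t < s → Et K k s a c ^ t ∈ DD K k s a c := fun t h1 h2 =>
    Submodule.mem_sup_right (Submodule.subset_span (Or.inl ⟨t, h1, by omega, rfl⟩))
  have cycD : ∀ t, k < 2 * t → t ≤ k →
      (Be K k s a c * Ga K k s a c * Al K k s a c) ^ t ∈ DD K k s a c := fun t h1 h2 =>
    Submodule.mem_sup_right (Submodule.subset_span (Or.inr ⟨t, h1, h2, rfl⟩))
  have yD : y ∈ DD K k s a c := Submodule.mem_sup_left hy
  have hX : ∃ y2 ∈ DD K k s a c, (∑ m ∈ Finset.Icc 1 k,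
      ρ m • (Be K k s a c * Ga K k s a c * Al K k s a c) ^ m) =
      ρ (k / 2) • (Be K k s a c * Ga K k s a c * Al K k s a c) ^ (k / 2) + y2 := by
    refine ⟨_, ?_, (Finset.add_sum_erase _ _ (Finset.mem_Icc.2 ⟨by omega, by omega⟩)).symm⟩
    refine Submodule.sum_mem _ (fun t ht => ?_)
    rw [Finset.mem_erase, Finset.mem_Icc] at ht
    rcases lt_or_ge k (2 * t) with h | h
    · exact Submodule.smul_mem _ _ (cycD t h (by omega))
    · rw [r0 t (by omega) (by omega), zero_smul]; exact Submodule.zero_mem _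
  obtain ⟨y2, hy2, e2⟩ := hX
  simp only [sumX (fun m => ρ m ^ 2)] at t5
  rcases Nat.even_or_odd s with hse | hso
  · have hs2 : 2 * (s / 2) = s := by rw [Nat.two_mul_div_two_of_even hse]
    refine ⟨μ, ν (s / 2), ρ (k / 2), fun h => absurd hse (Nat.not_even_iff_odd.2 h), ?_, ?_⟩
    · rw [Finset.sum_eq_single (s / 2)] at t5
      · rw [if_pos hs2] at t5
        simp only [mul_zero, mul_one, zero_add] at t5
        linear_combination t5
      · intro b _ hb
        rw [if_neg (by omega), mul_zero]
      · intro h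
        exact absurd (Finset.mem_Ico.2 ⟨by omega, by omega⟩) h
    · have hE : ∃ y3 ∈ DD K k s a c, (∑ m ∈ Finset.Ico 1 s, ν m • Et K k s a c ^ m) =
          ν (s / 2) • Et K k s a c ^ (s / 2) + y3 := by
        refine ⟨_, ?_, (Finset.add_sum_erase _ _ (Finset.mem_Ico.2 ⟨by omega, by omega⟩)).symm⟩
        refine Submodule.sum_mem _ (fun t ht => ?_)
        rw [Finset.mem_erase, Finset.mem_Ico] at ht
        rcases lt_or_ge s (2 * t) with h | h
        · exact Submodule.smul_mem _ _ (etaD t h (by omega))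
        · rw [n0 t (by omega) (by omega), zero_smul]; exact Submodule.zero_mem _
      obtain ⟨y3, hy3, e3⟩ := hE
      refine ⟨y + y3 + y2, Submodule.add_mem _ (Submodule.add_mem _ yD hy3) hy2, ?_⟩
      simp only [LL, LinearMap.coe_mk, AddHom.coe_mk, zero_smul, zero_add]
      rw [e3, e2]
      abel
  · have hs2 : ∀ t, 2 * t ≠ s := by
      intro t ht
      rw [← ht] at hso
      exact absurd (even_two_mul t) (Nat.not_even_iff_odd.2 hso)
    refine ⟨μ, 0, ρ (k / 2), fun _ => rfl, ?_, ?_⟩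
    · simp only [hs2, if_false, mul_zero, zero_add, Finset.sum_const_zero, add_zero] at t5
      linear_combination t5
    · have hE : (∑ m ∈ Finset.Ico 1 s, ν m • Et K k s a c ^ m) ∈ DD K k s a c := by
        refine Submodule.sum_mem _ (fun t ht => ?_)
        rw [Finset.mem_Ico] at ht
        have := hs2 t
        rcases lt_or_ge s (2 * t) with h | h
        · exact Submodule.smul_mem _ _ (etaD t h (by omega))
        · rw [n0 t (by omega) (by omega), zero_smul]; exact Submodule.zero_mem _
      refine ⟨y + (∑ m ∈ Finset.Ico 1 s, ν m • Et K k s a c ^ m) + y2,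
        Submodule.add_mem _ (Submodule.add_mem _ yD hE) hy2, ?_⟩
      simp only [LL, LinearMap.coe_mk, AddHom.coe_mk, zero_smul, zero_add]
      rw [e2]
      abel

/-- the final comparison -/
theorem compare (hk : 2 ≤ k) (hke : Even k) (hs : 3 ≤ s) (X : Set (Aa K k s a c)) (n : ℕ)
    (hn : ∀ t, n < 2 * t ↔ s < 2 * t)
    (h1 : ∀ x ∈ X, ∃ μ ν ρ : K, (Odd s → ν = 0) ∧ c * μ ^ 2 + ν ^ 2 + ρ ^ 2 = 0 ∧
      x = μ • Al K k s a c + ν • Et K k s a c ^ (s / 2) +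
      ρ • (Be K k s a c * Ga K k s a c * Al K k s a c) ^ (k / 2))
    (h2 : ∀ μ ν ρ : K, (Odd s → ν = 0) → c * μ ^ 2 + ν ^ 2 + ρ ^ 2 = 0 →
      μ • Al K k s a c + ν • Et K k s a c ^ (s / 2) +
      ρ • (Be K k s a c * Ga K k s a c * Al K k s a c) ^ (k / 2) ∈ Submodule.span K X) :
    (T1 K k s a c : Set (Aa K k s a c)) = ↑(comm K k s a c ⊔ Submodule.span K
          (X ∪ etaAbove K k s a c n ∪ cycAbove K k s a c k)) := by
  have hee : etaAbove K k s a c n = etaAbove K k s a c s := by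
    ext z; simp [etaAbove, hn]
  rw [hee]
  change (TS K k s a c : Set (Aa K k s a c)) = _
  rw [SetLike.coe_set_eq, Set.union_assoc, Submodule.span_union, ← sup_assoc, sup_comm (comm K k s a c),
    sup_assoc]
  change _ = Submodule.span K X ⊔ DD K k s a c
  apply le_antisymm
  · intro z hz
    obtain ⟨μ, ν, ρ, hν, h, y, hy, rfl⟩ := key_mp hk hke hs z hz
    exact Submodule.add_mem _ (Submodule.mem_sup_left (h2 μ ν ρ hν h)) (Submodule.mem_sup_right hy)
  · refine sup_le (Submodule.span_le.2 ?_) (DD_le hk hs)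
    intro x hx
    obtain ⟨μ, ν, ρ, hν, h, rfl⟩ := h1 x hx
    exact key_mpr hk hke hs μ ν ρ hν h

theorem char2_eq {x y : K} (h : x ^ 2 + y ^ 2 = 0) : x = y := by
  have : (x + y) ^ 2 = 0 := by rw [CharTwo.add_sq, h]
  exact CharTwo.add_eq_zero.1 (pow_eq_zero_iff (two_ne_zero)|>.1 this)

theorem char2_nsq {x y c : K} (hc : ¬ IsSquare c) (h : c * x ^ 2 + y ^ 2 = 0) : x = 0 ∧ y = 0 := by
  have h' : c * x ^ 2 = y ^ 2 := CharTwo.add_eq_zero.1 h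
  have hx : x = 0 := by
    by_contra hx
    apply hc
    refine ⟨y / x, ?_⟩
    field_simp
    exact h'
  subst hx
  simp at h
  exact ⟨rfl, h⟩

end final
end QT
open QT in
/-- char K = 2, k ≥ 2 even.  In A = A^{k,s}(a,c), the six cases for
T₁(A) = [A,A] + span(...) according to the parity of s and whether c is zero /
a nonzero square / a nonsquare. -/
theorem statement9 (K : Type) [Field K] [CharP K 2] (k s : ℕ)
    (hk : 2 ≤ k) (hkeven : Even k) (hs : 3 ≤ s) (a c : K) (ha : a ≠ 0) :
    (c = 0 → Odd s →
      (T1 K k s a c : Set (Aa K k s a c)) =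
        ↑(comm K k s a c ⊔ Submodule.span K
          ({Al K k s a c} ∪ etaAbove K k s a c (s - 1) ∪ cycAbove K k s a c k))) ∧
    (c = 0 → Even s →
      (T1 K k s a c : Set (Aa K k s a c)) =
        ↑(comm K k s a c ⊔ Submodule.span K
          ({Al K k s a c,
            (Et K k s a c) ^ (s / 2) +
              (Be K k s a c * Ga K k s a c * Al K k s a c) ^ (k / 2)} ∪
            etaAbove K k s a c s ∪ cycAbove K k s a c k))) ∧
    (Odd s → c ≠ 0 → ¬ IsSquare c →
      (T1 K k s a c : Set (Aa K k s a c)) =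
        ↑(comm K k s a c ⊔ Submodule.span K
          (etaAbove K k s a c (s - 1) ∪ cycAbove K k s a c k))) ∧
    (∀ d : K, Odd s → d ≠ 0 → c = d ^ 2 →
      (T1 K k s a c : Set (Aa K k s a c)) =
        ↑(comm K k s a c ⊔ Submodule.span K
          ({Al K k s a c +
              d • (Be K k s a c * Ga K k s a c * Al K k s a c) ^ (k / 2)} ∪
            etaAbove K k s a c (s - 1) ∪ cycAbove K k s a c k))) ∧
    (Even s → c ≠ 0 → ¬ IsSquare c →
      (T1 K k s a c : Set (Aa K k s a c)) =
        ↑(comm K k s a c ⊔ Submodule.span K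
          ({(Et K k s a c) ^ (s / 2) +
              (Be K k s a c * Ga K k s a c * Al K k s a c) ^ (k / 2)} ∪
            etaAbove K k s a c s ∪ cycAbove K k s a c k))) ∧
    (∀ d : K, Even s → d ≠ 0 → c = d ^ 2 →
      (T1 K k s a c : Set (Aa K k s a c)) =
        ↑(comm K k s a c ⊔ Submodule.span K
          ({(Et K k s a c) ^ (s / 2) +
              (Be K k s a c * Ga K k s a c * Al K k s a c) ^ (k / 2),
            Al K k s a c + d • (Et K k s a c) ^ (s / 2)} ∪
            etaAbove K k s a c s ∪ cycAbove K k s a c k))) := by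
  have c2 : (1 : K) + 1 = 0 := CharTwo.add_self_eq_zero 1
  have hodd : Odd s → ∀ t, s - 1 < 2 * t ↔ s < 2 * t := by
    rintro ⟨m, rfl⟩ t; omega
  refine ⟨?_, ?_, ?_, ?_, ?_, ?_⟩
  · rintro rfl hso
    refine compare hk hkeven hs _ _ (hodd hso) ?_ ?_
    · rintro x rfl
      exact ⟨1, 0, 0, fun _ => rfl, by simp, by simp⟩
    · intro μ ν ρ hν h
      rw [hν hso] at h ⊢
      have hρ : ρ = 0 := by simpa using h
      rw [hρ, Submodule.mem_span_singleton]
      exact ⟨μ, by simp⟩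
  · rintro rfl hse
    have hno : ¬ Odd s := Nat.not_odd_iff_even.2 hse
    refine compare hk hkeven hs _ _ (fun _ => Iff.rfl) ?_ ?_
    · rintro x (rfl | rfl)
      · exact ⟨1, 0, 0, fun _ => rfl, by simp, by simp⟩
      · exact ⟨0, 1, 1, fun h => absurd h hno, by simp [c2], by simp⟩
    · intro μ ν ρ hν h
      have hρ : ν = ρ := char2_eq (by simpa using h)
      rw [hρ, Submodule.mem_span_pair]
      exact ⟨μ, ρ, by rw [smul_add, add_assoc]⟩
  · intro hso hc0 hc
    have := compare (a := a) (c := c) hk hkeven hs ∅ _ (hodd hso) (by simp) ?_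
    · rwa [Set.empty_union] at this
    · intro μ ν ρ hν h
      rw [hν hso] at h ⊢
      obtain ⟨rfl, rfl⟩ := char2_nsq hc (x := μ) (y := ρ) (by simpa using h)
      simp
  · rintro d hso hd rfl
    refine compare hk hkeven hs _ _ (hodd hso) ?_ ?_
    · rintro x rfl
      exact ⟨1, 0, d, fun _ => rfl, by simp [CharTwo.add_self_eq_zero], by simp⟩
    · intro μ ν ρ hν h
      rw [hν hso] at h ⊢
      have hρ : μ * d = ρ := char2_eq (by rw [← h]; ring)
      rw [← hρ, Submodule.mem_span_singleton]
      exact ⟨μ, by rw [smul_add, smul_smul]; simp⟩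
  · intro hse hc0 hc
    have hno : ¬ Odd s := Nat.not_odd_iff_even.2 hse
    refine compare hk hkeven hs _ _ (fun _ => Iff.rfl) ?_ ?_
    · rintro x rfl
      exact ⟨0, 1, 1, fun h => absurd h hno, by simp [c2], by simp⟩
    · intro μ ν ρ hν h
      obtain ⟨rfl, h2⟩ := char2_nsq hc (x := μ) (y := ν + ρ)
        (by rw [CharTwo.add_sq, ← add_assoc]; exact h)
      rw [CharTwo.add_eq_zero.1 h2, Submodule.mem_span_singleton]
      exact ⟨ρ, by simp⟩
  · rintro d hse hd rfl
    have hno : ¬ Odd s := Nat.not_odd_iff_even.2 hse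
    refine compare hk hkeven hs _ _ (fun _ => Iff.rfl) ?_ ?_
    · rintro x (rfl | rfl)
      · exact ⟨0, 1, 1, fun h => absurd h hno, by simp [c2], by simp⟩
      · exact ⟨1, d, 0, fun h => absurd h hno, by simp [CharTwo.add_self_eq_zero], by simp⟩
    · intro μ ν ρ hν h
      have hν' : μ * d + ρ = ν := char2_eq (by rw [CharTwo.add_sq, ← h]; ring)
      rw [← hν', Submodule.mem_span_pair]
      refine ⟨ρ, μ, ?_⟩
      rw [smul_add, smul_add, smul_smul, add_smul]
      abel
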